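/- arXiv:1902.10894 — 3 statements merged into one kernel-verified Lean document; each statement's English description precedes it below -/
import Mathlib

section
/- Let Z = (Z₁, …, Z_n) be a centered Gaussian random vector with invertible covariance matrix Σ, and suppose that θ := Σ^{-1}𝟏 (where 𝟏 is the all-ones vector) has all entries strictly positive. Set ν_j = θ_j / (Σ_{i=1}^n θ_i) and Y = Σ_{i=1}^n ν_i Z_i. Then for every j ∈ {1, …, n}, lim_{x↓0} P( Z_j = min_{1≤i≤n} Z_i | Y ≤ x, min_{1≤i≤n} Z_i > 0 ) = ν_j. -/
open MeasureTheory ProbabilityTheory Filter Set Matrix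

/-- The standard Gaussian measure on `ι → ℝ` has the product of the Gaussian densities as its
density. -/
lemma pi_gaussianReal_eq_withDensity {ι : Type*} [Fintype ι] :
    Measure.pi (fun _ : ι => gaussianReal 0 1) =
      (volume : Measure (ι → ℝ)).withDensity
        (fun z => ENNReal.ofReal (∏ i, gaussianPDFReal 0 1 (z i))) := by
  refine (Measure.pi_eq fun s hs => ?_)
  rw [withDensity_apply _ (MeasurableSet.univ_pi hs), volume_pi, Measure.restrict_pi_pi,
    ← ofReal_integral_eq_lintegral_ofReal]
  · rw [integral_fintype_prod_eq_prod (fun _ x => gaussianPDFReal 0 1 x),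
      ENNReal.ofReal_prod_of_nonneg]
    · refine Finset.prod_congr rfl fun i _ => ?_
      rw [gaussianReal_apply_eq_integral _ one_ne_zero]
    · exact fun i _ => integral_nonneg fun x => gaussianPDFReal_nonneg _ _ _
  · exact Integrable.fintype_prod fun i => (integrable_gaussianPDFReal 0 1).integrableOn
  · exact .of_forall fun z => Finset.prod_nonneg fun i _ => gaussianPDFReal_nonneg _ _ _

open scoped Pointwise in
lemma tendsto_withDensity_smul_set_div {E : Type*} [NormedAddCommGroup E] [NormedSpace ℝ E]
    [MeasurableSpace E] [BorelSpace E] [FiniteDimensional ℝ E] (μ : Measure E)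
    [μ.IsAddHaarMeasure] {g : E → ℝ} (hg : Continuous g) (hg0 : ∀ z, 0 ≤ g z) {B : Set E}
    (hB : Bornology.IsBounded B) (hBm : MeasurableSet B) :
    Tendsto (fun x : ℝ => (μ.withDensity fun z => ENNReal.ofReal (g z)).real (x • B) /
        x ^ Module.finrank ℝ E) (nhdsWithin 0 (Ioi 0)) (nhds (g 0 * μ.real B)) := by
  have hsmall : Tendsto (fun x : ℝ => x • B) (nhdsWithin 0 (Ioi 0)) (nhds (0 : E)).smallSets := by
    rw [tendsto_smallSets_iff]
    intro t ht
    exact ((NormedSpace.isVonNBounded_of_isBounded ℝ hB ht).eventually_nhds_zero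
      (mem_of_mem_nhds ht)).filter_mono nhdsWithin_le_nhds |>.mono fun x hx => by
        rintro _ ⟨z, hz, rfl⟩; exact hx hz
  have key := (hg.continuousAt (x := 0)).integral_sub_linear_isLittleO_ae (μ := μ)
    hg.aestronglyMeasurable.stronglyMeasurableAtFilter hsmall
  have hreal : ∀ x : ℝ, 0 < x →
      μ.real (x • B) = x ^ Module.finrank ℝ E * μ.real B := fun x hx => by
    rw [Measure.real, Measure.addHaar_smul_of_nonneg _ hx.le, ENNReal.toReal_mul,
      ENNReal.toReal_ofReal (by positivity), Measure.real]
  have hint : ∀ x : ℝ, 0 < x → (μ.withDensity fun z => ENNReal.ofReal (g z)).real (x • B) =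
      ∫ z in x • B, g z ∂μ := fun x hx => by
    rw [Measure.real, withDensity_apply _ (hBm.const_smul₀ x),
      integral_eq_lintegral_of_nonneg_ae (.of_forall hg0) hg.aestronglyMeasurable]
  have hO : (fun x : ℝ => μ.real (x • B)) =O[nhdsWithin 0 (Ioi 0)]
      fun x => x ^ Module.finrank ℝ E := by
    refine Asymptotics.IsBigO.of_bound (μ.real B) ?_
    filter_upwards [self_mem_nhdsWithin] with x hx
    rw [hreal x hx, norm_mul, mul_comm, Real.norm_of_nonneg measureReal_nonneg]
  have h2 := (key.trans_isBigO hO).tendsto_div_nhds_zero.add_const (g 0 * μ.real B)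
  rw [zero_add] at h2
  refine h2.congr' ?_
  filter_upwards [self_mem_nhdsWithin] with x hx
  have hx' : x ^ Module.finrank ℝ E ≠ 0 := (pow_pos hx _).ne'
  rw [hint x hx, hreal x hx, smul_eq_mul]
  field_simp
  ring

open scoped Pointwise in
lemma tendsto_withDensity_smul_set_ratio {E : Type*} [NormedAddCommGroup E] [NormedSpace ℝ E]
    [MeasurableSpace E] [BorelSpace E] [FiniteDimensional ℝ E] (μ : Measure E)
    [μ.IsAddHaarMeasure] {g : E → ℝ} (hg : Continuous g) (hg0 : ∀ z, 0 ≤ g z) (hpos : 0 < g 0)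
    {B C : Set E} (hB : Bornology.IsBounded B) (hBm : MeasurableSet B)
    (hC : Bornology.IsBounded C) (hCm : MeasurableSet C) (hC0 : μ.real C ≠ 0) :
    Tendsto (fun x : ℝ => (μ.withDensity fun z => ENNReal.ofReal (g z)).real (x • B) /
        (μ.withDensity fun z => ENNReal.ofReal (g z)).real (x • C))
      (nhdsWithin 0 (Ioi 0)) (nhds (μ.real B / μ.real C)) := by
  have h := (tendsto_withDensity_smul_set_div μ hg hg0 hB hBm).div
    (tendsto_withDensity_smul_set_div μ hg hg0 hC hCm) (mul_ne_zero hpos.ne' hC0)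
  rw [mul_div_mul_left _ _ hpos.ne'] at h
  refine h.congr' ?_
  filter_upwards [self_mem_nhdsWithin] with x hx
  exact div_div_div_cancel_right₀ (pow_pos hx _).ne' _ _

/-- The part of the corner simplex where the `j`-th coordinate is minimal is, up to a null set,
the image of the simplex under a linear map of determinant `ν j`. -/
lemma volume_simplex_min_eq {ι : Type*} [Fintype ι] [DecidableEq ι] {ν : ι → ℝ}
    (hν : ∀ i, 0 < ν i) (hsum : ∑ i, ν i = 1) (j : ι) :
    volume.real {z : ι → ℝ | (∑ i, ν i * z i ≤ 1 ∧ ∀ i, 0 < z i) ∧ ∀ i, z j ≤ z i} =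
      ν j * volume.real {z : ι → ℝ | ∑ i, ν i * z i ≤ 1 ∧ ∀ i, 0 < z i} := by
  set M : Matrix ι ι ℝ := (1 : Matrix ι ι ℝ).updateCol j fun _ => ν j with hM
  have hdet : M.det = ν j := by
    rw [hM, ← Matrix.cramer_apply, Matrix.cramer_one]; rfl
  have happ : ∀ u i, (M *ᵥ u) i = (if i = j then 0 else u i) + ν j * u j := by
    intro u i
    rw [Matrix.mulVec, dotProduct, ← Finset.sum_erase_add _ _ (Finset.mem_univ j)]
    congr 1
    · rw [Finset.sum_congr rfl (g := fun k => if i = k then u k else 0)]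
      · simp [Finset.sum_ite_eq]
      · intro k hk
        simp [hM, Finset.ne_of_mem_erase hk, Matrix.one_apply]
    · simp [hM]
  have hsumM : ∀ u, ∑ i, ν i * (M *ᵥ u) i = ∑ i, ν i * u i := by
    intro u
    simp_rw [happ, mul_add, Finset.sum_add_distrib, ← Finset.sum_mul, hsum, one_mul]
    rw [← Finset.sum_erase_add _ _ (Finset.mem_univ j),
      ← Finset.sum_erase_add _ (fun i => ν i * u i) (Finset.mem_univ j)]
    simp only [if_true, mul_zero, add_zero]
    congr 1
    exact Finset.sum_congr rfl fun k hk => by rw [if_neg (Finset.ne_of_mem_erase hk)]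
  have hpre := Measure.addHaar_preimage_linearMap (volume : Measure (ι → ℝ))
    (f := Matrix.toLin' M) (by rw [LinearMap.det_toLin', hdet]; exact (hν j).ne')
    {z : ι → ℝ | (∑ i, ν i * z i ≤ 1 ∧ ∀ i, 0 < z i) ∧ ∀ i, z j ≤ z i}
  have hae : (Matrix.toLin' M ⁻¹'
      {z : ι → ℝ | (∑ i, ν i * z i ≤ 1 ∧ ∀ i, 0 < z i) ∧ ∀ i, z j ≤ z i} : Set (ι → ℝ))
      =ᵐ[volume] {z : ι → ℝ | ∑ i, ν i * z i ≤ 1 ∧ ∀ i, 0 < z i} := by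
    have hne : ∀ᵐ u : ι → ℝ, ∀ i, u i ≠ 0 := by
      rw [ae_all_iff]
      exact fun i => (Measure.quasiMeasurePreserving_eval (fun _ : ι => (volume : Measure ℝ)) i).ae
        (Measure.ae_ne volume (0 : ℝ))
    filter_upwards [hne] with u hu
    apply propext
    change ((∑ i, ν i * (Matrix.toLin' M u) i ≤ 1 ∧ ∀ i, 0 < (Matrix.toLin' M u) i) ∧
      ∀ i, (Matrix.toLin' M u) j ≤ (Matrix.toLin' M u) i) ↔
      (∑ i, ν i * u i ≤ 1 ∧ ∀ i, 0 < u i)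
    simp only [Matrix.toLin'_apply, hsumM]
    simp only [happ, if_true, zero_add]
    constructor
    · rintro ⟨⟨h1, h2⟩, h3⟩
      refine ⟨h1, fun i => ?_⟩
      by_cases hij : i = j
      · have := h2 j
        simp only [if_true, zero_add] at this
        rw [hij]
        exact (mul_pos_iff_of_pos_left (hν j)).1 this
      · have := h3 i
        rw [if_neg hij] at this
        exact lt_of_le_of_ne (by linarith) (hu i).symm
    · rintro ⟨h1, h2⟩
      have hj := mul_pos (hν j) (h2 j)
      refine ⟨⟨h1, fun i => ?_⟩, fun i => ?_⟩
      · split_ifs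
        · linarith
        · linarith [h2 i]
      · split_ifs
        · linarith
        · linarith [h2 i]
  rw [measure_congr hae, LinearMap.det_toLin', hdet] at hpre
  rw [Measure.real, Measure.real, hpre, ENNReal.toReal_mul, ENNReal.toReal_ofReal (abs_nonneg _),
    abs_of_pos (inv_pos.2 (hν j)), mul_inv_cancel_left₀ (hν j).ne']

lemma isBounded_simplex {ι : Type*} [Fintype ι] {ν : ι → ℝ} (hν : ∀ i, 0 < ν i) :
    Bornology.IsBounded {z : ι → ℝ | ∑ i, ν i * z i ≤ 1 ∧ ∀ i, 0 < z i} := by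
  refine (Metric.isBounded_Icc (0 : ι → ℝ) fun i => (ν i)⁻¹).subset ?_
  rintro z ⟨h1, h2⟩
  refine ⟨fun i => (h2 i).le, fun i => ?_⟩
  have := Finset.single_le_sum (f := fun i => ν i * z i)
    (fun k _ => (mul_pos (hν k) (h2 k)).le) (Finset.mem_univ i)
  change z i ≤ (ν i)⁻¹
  rw [← one_div, le_div_iff₀ (hν i), mul_comm]
  exact this.trans h1

lemma volume_simplex_pos {ι : Type*} [Fintype ι] {ν : ι → ℝ} (hsum : ∑ i, ν i = 1) :
    0 < volume {z : ι → ℝ | ∑ i, ν i * z i ≤ 1 ∧ ∀ i, 0 < z i} := by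
  have hopen : IsOpen {z : ι → ℝ | ∑ i, ν i * z i < 1 ∧ ∀ i, 0 < z i} := by
    refine (isOpen_lt (f := fun z : ι → ℝ => ∑ i, ν i * z i) (by fun_prop)
      continuous_const).inter ?_
    change IsOpen {z : ι → ℝ | ∀ i, 0 < z i}
    rw [ofPred_forall]
    exact isOpen_iInter_of_finite fun i => isOpen_lt continuous_const (continuous_apply i)
  refine (hopen.measure_pos volume ⟨fun _ => 1 / 2, ?_, fun _ => by norm_num⟩).trans_le
    (measure_mono fun z hz => ⟨hz.1.le, hz.2⟩)
  rw [← Finset.sum_mul, hsum]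
  norm_num

lemma measurableSet_simplex {ι : Type*} [Fintype ι] (ν : ι → ℝ) (x : ℝ) :
    MeasurableSet {z : ι → ℝ | ∑ i, ν i * z i ≤ x ∧ ∀ i, 0 < z i} := by
  refine (measurableSet_le (f := fun z : ι → ℝ => ∑ i, ν i * z i) (by fun_prop)
    measurable_const).inter ?_
  change MeasurableSet {z : ι → ℝ | ∀ i, 0 < z i}
  rw [ofPred_forall]
  exact MeasurableSet.iInter fun i => measurableSet_lt measurable_const (measurable_pi_apply i)

open scoped MatrixOrder in
/-- A random vector all of whose linear combinations are centered Gaussian with variance given by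
the positive semidefinite matrix `S` has the law of the image of a standard Gaussian vector under
the square root of `S`. -/
lemma map_eq_map_sqrt_mulVec_pi_gaussianReal {Ω ι : Type*} [Fintype ι] [DecidableEq ι]
    [MeasurableSpace Ω] {P : Measure Ω} [IsProbabilityMeasure P] {Z : ι → Ω → ℝ}
    (hZ : ∀ i, Measurable (Z i)) {S : Matrix ι ι ℝ} (hS : S.PosSemidef)
    (hGauss : ∀ c : ι → ℝ, Measure.map (fun ω => ∑ i, c i * Z i ω) P =
      gaussianReal 0 (Real.toNNReal (c ⬝ᵥ S.mulVec c))) :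
    P.map (fun ω i => Z i ω) =
      (Measure.pi fun _ : ι => gaussianReal 0 1).map (CFC.sqrt S *ᵥ ·) := by
  have hZm : Measurable fun ω i => Z i ω := measurable_pi_lambda _ hZ
  have hlaw : P.map (fun ω => WithLp.toLp 2 fun i => Z i ω) = multivariateGaussian 0 S := by
    apply Measure.ext_of_charFun
    ext t
    have hnn : 0 ≤ t.ofLp ⬝ᵥ S *ᵥ t.ofLp := by simpa using hS.dotProduct_mulVec_nonneg t.ofLp
    have h1 := congrArg (fun m => charFun m 1) (hGauss t.ofLp)
    simp only [charFun_gaussianReal] at h1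
    rw [charFun_apply_real, integral_map (by fun_prop) (by fun_prop)] at h1
    rw [charFun_multivariateGaussian hS, charFun_apply, integral_map (by fun_prop) (by fun_prop)]
    convert! h1 using 1
    · simp [PiLp.inner_apply]
    · simp [hnn]
  have h2 := congrArg (Measure.map (WithLp.ofLp : EuclideanSpace ℝ ι → ι → ℝ)) hlaw
  rw [Measure.map_map (by fun_prop) (by fun_prop)] at h2
  rw [multivariateGaussian, ← map_pi_eq_stdGaussian, Measure.map_map (by fun_prop) (by fun_prop),
    Measure.map_map (by fun_prop) (by fun_prop)] at h2
  convert! h2 using 2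
  ext w
  simp

open scoped MatrixOrder in
/-- A nondegenerate centered Gaussian vector has the law of the image of a standard Gaussian vector
under an invertible matrix. -/
lemma exists_map_eq_map_mulVec_pi_gaussianReal {Ω ι : Type*} [Fintype ι] [DecidableEq ι]
    [MeasurableSpace Ω] {P : Measure Ω} [IsProbabilityMeasure P] {Z : ι → Ω → ℝ}
    (hZ : ∀ i, Measurable (Z i)) {S : Matrix ι ι ℝ} (hS : S.PosSemidef) (hdet : IsUnit S.det)
    (hGauss : ∀ c : ι → ℝ, Measure.map (fun ω => ∑ i, c i * Z i ω) P =
      gaussianReal 0 (Real.toNNReal (c ⬝ᵥ S.mulVec c))) :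
    ∃ A : Matrix ι ι ℝ, A.det ≠ 0 ∧ P.map (fun ω i => Z i ω) =
      (Measure.pi fun _ : ι => gaussianReal 0 1).map (A *ᵥ ·) := by
  refine ⟨CFC.sqrt S, fun h => ?_, map_eq_map_sqrt_mulVec_pi_gaussianReal hZ hS hGauss⟩
  rw [← CFC.sqrt_mul_sqrt_self S hS.nonneg, det_mul, h, mul_zero] at hdet
  exact not_isUnit_zero hdet

/-- A covariance matrix is positive semidefinite. -/
lemma posSemidef_of_integral_mul_eq {Ω ι : Type*} [Fintype ι]
    [MeasurableSpace Ω] {P : Measure Ω} {Z : ι → Ω → ℝ} (hZ : ∀ i, MemLp (Z i) 2 P)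
    {S : Matrix ι ι ℝ} (hcov : ∀ i j, (∫ ω, Z i ω * Z j ω ∂P) = S i j) : S.PosSemidef := by
  refine Matrix.PosSemidef.of_dotProduct_mulVec_nonneg ?_ fun c => ?_
  · ext i j
    simp [← hcov, mul_comm]
  · have hint : ∀ i j, Integrable (fun ω => c i * (Z i ω * (Z j ω * c j))) P := fun i j => by
      simpa only [Pi.mul_apply, mul_assoc] using
        (((hZ i).integrable_mul (hZ j)).mul_const (c j)).const_mul (c i)
    have : star c ⬝ᵥ S *ᵥ c = ∫ ω, (∑ i, c i * Z i ω) ^ 2 ∂P := by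
      simp_rw [sq, Finset.sum_mul_sum, dotProduct, mulVec, dotProduct, Finset.mul_sum]
      rw [integral_finsetSum _ fun i _ => integrable_finsetSum _ fun j _ => by
        convert! hint i j using 2; ring]
      refine Finset.sum_congr rfl fun i _ => ?_
      rw [integral_finsetSum _ fun j _ => by convert! hint i j using 2; ring]
      refine Finset.sum_congr rfl fun j _ => ?_
      rw [← hcov, ← integral_mul_const, ← integral_const_mul]
      refine integral_congr_ae (.of_forall fun ω => ?_)
      simp only [star_trivial]
      ring
    rw [this]
    exact integral_nonneg fun ω => sq_nonneg _

open scoped Pointwise in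
/-- Intersecting with a cone, the scaled simplices are dilations of the unit one, also after pulling
back by a linear map. -/
lemma preimage_scaled_simplex_inter_cone {ι : Type*} [Fintype ι] (A : Matrix ι ι ℝ) (ν : ι → ℝ)
    {x : ℝ} (hx : 0 < x) {C : Set (ι → ℝ)} (hC : ∀ c : ℝ, 0 < c → ∀ z, c • z ∈ C ↔ z ∈ C) :
    (A *ᵥ ·) ⁻¹' ({z | ∑ i, ν i * z i ≤ x ∧ ∀ i, 0 < z i} ∩ C) =
      x • ((A *ᵥ ·) ⁻¹' ({z | ∑ i, ν i * z i ≤ 1 ∧ ∀ i, 0 < z i} ∩ C)) := by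
  ext w
  have hsum : ∑ i, ν i * (x⁻¹ • A *ᵥ w) i = x⁻¹ * ∑ i, ν i * (A *ᵥ w) i := by
    rw [Finset.mul_sum]
    exact Finset.sum_congr rfl fun i _ => by simp only [Pi.smul_apply, smul_eq_mul]; ring
  rw [mem_smul_set_iff_inv_smul_mem₀ hx.ne']
  simp only [mem_preimage, mulVec_smul, mem_inter_iff, mem_ofPred_eq, hC _ (inv_pos.2 hx), hsum]
  simp only [Pi.smul_apply, smul_eq_mul, inv_mul_le_one₀ hx, mul_pos_iff_of_pos_left (inv_pos.2 hx)]

/-- Let `Z` be a centered Gaussian vector in `ℝⁿ` with invertible covariance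
matrix `S` such that `θ = S⁻¹ 𝟏` has strictly positive entries. With `ν_j = θ_j / Σᵢ θᵢ`
and `Y = Σᵢ νᵢ Zᵢ`, for every `j`,
`lim_{x↓0} P(Z_j = minᵢ Zᵢ | Y ≤ x, minᵢ Zᵢ > 0) = ν_j`. -/
theorem conditional_location_of_min_of_gaussian_vector
    {Ω : Type*} [MeasurableSpace Ω] (P : Measure Ω) [IsProbabilityMeasure P]
    (n : ℕ) (hn : 0 < n)
    (Z : Fin n → Ω → ℝ) (hZ_meas : ∀ i, Measurable (Z i))
    (S : Matrix (Fin n) (Fin n) ℝ) (hS_inv : IsUnit S.det)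
    -- Z is a centered Gaussian vector with covariance matrix S
    (hGauss : ∀ c : Fin n → ℝ,
      Measure.map (fun ω => ∑ i, c i * Z i ω) P =
        gaussianReal 0 (Real.toNNReal (c ⬝ᵥ S.mulVec c)))
    (hcov : ∀ i j, (∫ ω, Z i ω * Z j ω ∂P) = S i j)
    -- θ = S⁻¹ 𝟏 has strictly positive entries
    (θ : Fin n → ℝ) (hθ : θ = S⁻¹.mulVec fun _ => 1)
    (hθ_pos : ∀ i, 0 < θ i)
    (ν : Fin n → ℝ) (hν : ∀ j, ν j = θ j / ∑ i, θ i)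
    (Y : Ω → ℝ) (hY : ∀ ω, Y ω = ∑ i, ν i * Z i ω) :
    ∀ j : Fin n,
      Tendsto (fun x : ℝ =>
          (ProbabilityTheory.cond P {ω | Y ω ≤ x ∧ ∀ i, 0 < Z i ω}
            {ω | ∀ i, Z j ω ≤ Z i ω}).toReal)
        (nhdsWithin 0 (Ioi 0)) (nhds (ν j)) := by
  intro j
  have hθsum : 0 < ∑ i, θ i := Finset.sum_pos (fun i _ => hθ_pos i) ⟨j, Finset.mem_univ j⟩
  have hνpos : ∀ i, 0 < ν i := fun i => by rw [hν]; exact div_pos (hθ_pos i) hθsum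
  have hνsum : ∑ i, ν i = 1 := by
    simp_rw [hν, ← Finset.sum_div]; exact div_self hθsum.ne'
  have hL2 : ∀ i, MemLp (Z i) 2 P := fun i => by
    have h := hGauss (Pi.single i 1)
    simp only [Pi.single_apply, ite_mul, one_mul, zero_mul, Finset.sum_ite_eq', Finset.mem_univ,
      if_true] at h
    have h2 : MemLp id 2 (P.map (Z i)) := by rw [h]; exact memLp_id_gaussianReal 2
    exact (memLp_map_measure_iff (by fun_prop) (hZ_meas i).aemeasurable).1 h2
  have hS : S.PosSemidef := posSemidef_of_integral_mul_eq hL2 hcov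
  have hZm : Measurable fun ω i => Z i ω := measurable_pi_lambda _ hZ_meas
  obtain ⟨A, hAdet, hlaw⟩ := exists_map_eq_map_mulVec_pi_gaussianReal hZ_meas hS hS_inv hGauss
  rw [pi_gaussianReal_eq_withDensity] at hlaw
  set g : (Fin n → ℝ) → ℝ := fun z => ∏ i, gaussianPDFReal 0 1 (z i) with hg
  set K : Set (Fin n → ℝ) := {z | ∑ i, ν i * z i ≤ 1 ∧ ∀ i, 0 < z i} with hK
  set C : Set (Fin n → ℝ) := {z | ∀ i, z j ≤ z i} with hCdef
  have hAm : Measurable fun z => A *ᵥ z := (Continuous.matrix_mulVec continuous_const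
    continuous_id).measurable
  have hCm : MeasurableSet C := by
    simp only [hCdef, ofPred_forall]
    exact MeasurableSet.iInter fun i =>
      measurableSet_le (measurable_pi_apply j) (measurable_pi_apply i)
  have hCcone : ∀ c : ℝ, 0 < c → ∀ z, c • z ∈ C ↔ z ∈ C := fun c hc z => by
    simp [hCdef, hc]
  have hgcont : Continuous g := continuous_finsetProd _ fun i _ => by
    unfold gaussianPDFReal; fun_prop
  have hgnn : ∀ z, 0 ≤ g z := fun z => Finset.prod_nonneg fun i _ => gaussianPDFReal_nonneg _ _ _
  have hg0 : 0 < g 0 := Finset.prod_pos fun i _ => gaussianPDFReal_pos _ _ _ one_ne_zero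
  have hvol : ∀ B : Set (Fin n → ℝ),
      volume.real ((A *ᵥ ·) ⁻¹' B) = |A.det⁻¹| * volume.real B := fun B => by
    have h := Measure.addHaar_preimage_linearMap (volume : Measure (Fin n → ℝ))
      (f := Matrix.toLin' A) (by rwa [LinearMap.det_toLin']) B
    rw [LinearMap.det_toLin'] at h
    rw [Measure.real, Measure.real, ← ENNReal.toReal_ofReal (abs_nonneg A.det⁻¹),
      ← ENNReal.toReal_mul, ← h]
    rfl
  have hKm : MeasurableSet K := measurableSet_simplex ν 1
  have hKb : Bornology.IsBounded ((A *ᵥ ·) ⁻¹' K) := by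
    have hinv : IsUnit A.det := isUnit_iff_ne_zero.2 hAdet
    refine ((isBounded_simplex hνpos).isCompact_closure.image
      (f := fun z => A⁻¹ *ᵥ z) (by fun_prop)).isBounded.subset fun w hw =>
        ⟨A *ᵥ w, subset_closure hw, ?_⟩
    simp [mulVec_mulVec, nonsing_inv_mul A hinv]
  have hKpos : volume.real K ≠ 0 := (ENNReal.toReal_pos (volume_simplex_pos hνsum).ne'
    (isBounded_simplex hνpos).measure_lt_top.ne).ne'
  have hlim := tendsto_withDensity_smul_set_ratio (volume : Measure (Fin n → ℝ)) hgcont hgnn hg0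
    (B := (A *ᵥ ·) ⁻¹' (K ∩ C)) (C := (A *ᵥ ·) ⁻¹' K)
    (hKb.subset (preimage_mono inter_subset_left)) (hAm (hKm.inter hCm)) hKb (hAm hKm)
    (by rw [hvol]; exact mul_ne_zero (abs_pos.2 (inv_ne_zero hAdet)).ne' hKpos)
  have hKC : volume.real (K ∩ C) = ν j * volume.real K := volume_simplex_min_eq hνpos hνsum j
  rw [hvol, hvol, mul_div_mul_left _ _ (abs_pos.2 (inv_ne_zero hAdet)).ne', hKC,
    mul_div_cancel_right₀ _ hKpos] at hlim
  refine hlim.congr' ?_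
  filter_upwards [self_mem_nhdsWithin] with x hx
  have hKxm : MeasurableSet {z : Fin n → ℝ | ∑ i, ν i * z i ≤ x ∧ ∀ i, 0 < z i} :=
    measurableSet_simplex ν x
  have hPx : ∀ B : Set (Fin n → ℝ), MeasurableSet B → P ((fun ω i => Z i ω) ⁻¹' B) =
      (volume.withDensity fun z => ENNReal.ofReal (g z)) ((A *ᵥ ·) ⁻¹' B) := fun B hB => by
    rw [← Measure.map_apply hZm hB, hlaw, Measure.map_apply hAm hB]
  have hE : {ω | Y ω ≤ x ∧ ∀ i, 0 < Z i ω} = (fun ω i => Z i ω) ⁻¹'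
      {z : Fin n → ℝ | ∑ i, ν i * z i ≤ x ∧ ∀ i, 0 < z i} := by
    ext ω; simp [hY]
  have hscale := preimage_scaled_simplex_inter_cone A ν hx hCcone
  have hscale' := preimage_scaled_simplex_inter_cone A ν hx (C := univ) (by simp)
  simp only [inter_univ] at hscale'
  rw [hE, cond_apply (hZm hKxm), show {ω | ∀ i, Z j ω ≤ Z i ω} = (fun ω i => Z i ω) ⁻¹' C from rfl,
    ← preimage_inter, hPx _ hKxm, hPx _ (hKxm.inter hCm), hscale, hscale', ENNReal.toReal_mul,
    ENNReal.toReal_inv, mul_comm, ← div_eq_mul_inv]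
  rfl
end

section
/- Let (B(t), t ≥ 0) be standard Brownian motion, fix 0 < α < 1 and 0 < a < b < ∞, and let X(t) = t^{−α} B(t), whose covariance is R(s,t) = s^{1−α} t^{−α} for a ≤ s ≤ t ≤ b. Then the finite measure μ_α on [a,b] defined by μ_α(dx) = α(1−α) x^{2α−2} dx + (1−α) a^{2α−1} δ_a(dx) + α b^{2α−1} δ_b(dx) is a constant multiple of an optimal measure; that is, μ_α / μ_α([a,b]) minimizes I(ν) = ∫∫ R(s,t) ν(ds) ν(dt) over Borel probability measures on [a,b]. -/
open MeasureTheory Filter Set Real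

/-- The energy functional `I(ν) = ∫∫ R(s,t) ν(ds) ν(dt)`. -/
noncomputable def kernelEnergy (R : ℝ → ℝ → ℝ) (ν : Measure ℝ) : ℝ :=
  ∫ s, ∫ t, R s t ∂ν ∂ν

/-- Fubini for a kernel with a bounded square-root factorisation
`K(s,t) = ∫ f(s,u) f(t,u) dρ(u)`: the mutual energy of two finite measures is the `L²(ρ)`-pairing
of their transforms. -/
lemma integral_integral_factored_kernel {f : ℝ → ℝ → ℝ} {C : ℝ}
    (hf : Measurable (Function.uncurry f)) (hC : ∀ s u, |f s u| ≤ C)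
    (ρ μ ν : Measure ℝ) [IsFiniteMeasure ρ] [IsFiniteMeasure μ] [IsFiniteMeasure ν] :
    ∫ s, ∫ t, ∫ u, f s u * f t u ∂ρ ∂ν ∂μ =
      ∫ u, (∫ s, f s u ∂μ) * (∫ t, f t u ∂ν) ∂ρ := by
  have hC0 : 0 ≤ C := (abs_nonneg _).trans (hC 0 0)
  have hinner (s : ℝ) : ∫ t, ∫ u, f s u * f t u ∂ρ ∂ν = ∫ u, f s u * ∫ t, f t u ∂ν ∂ρ := by
    rw [integral_integral_swap]
    · simp_rw [integral_const_mul]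
    · refine Integrable.of_bound (C := C * C) ?_ (ae_of_all _ fun p => ?_)
      · exact ((hf.comp (measurable_const.prodMk measurable_snd)).mul hf).aestronglyMeasurable
      · simp only [Function.uncurry, norm_mul, Real.norm_eq_abs]
        exact mul_le_mul (hC _ _) (hC _ _) (abs_nonneg _) hC0
  simp_rw [hinner]
  have hG : StronglyMeasurable fun u => ∫ t, f t u ∂ν :=
    hf.stronglyMeasurable.integral_prod_left
  rw [integral_integral_swap]
  · simp_rw [integral_mul_const]
  · refine Integrable.of_bound (C := C * (C * ν.real univ)) ?_ (ae_of_all _ fun p => ?_)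
    · exact (hf.mul (hG.measurable.comp measurable_snd)).aestronglyMeasurable
    · simp only [Function.uncurry, norm_mul]
      refine mul_le_mul (hC _ _) ?_ (norm_nonneg _) hC0
      exact norm_integral_le_of_norm_le_const (ae_of_all _ fun t => hC t _)

/-- Nonnegativity of the energy of `ν - c μ` for a kernel with a bounded square-root
factorisation. -/
lemma factored_kernel_energy_ge {f : ℝ → ℝ → ℝ} {C : ℝ}
    (hf : Measurable (Function.uncurry f)) (hC : ∀ s u, |f s u| ≤ C)
    (ρ μ ν : Measure ℝ) [IsFiniteMeasure ρ] [IsFiniteMeasure μ] [IsFiniteMeasure ν] (c : ℝ) :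
    2 * c * (∫ s, ∫ t, ∫ u, f s u * f t u ∂ρ ∂μ ∂ν)
        - c ^ 2 * (∫ s, ∫ t, ∫ u, f s u * f t u ∂ρ ∂μ ∂μ) ≤
      ∫ s, ∫ t, ∫ u, f s u * f t u ∂ρ ∂ν ∂ν := by
  simp only [integral_integral_factored_kernel hf hC]
  have hG (κ : Measure ℝ) [IsFiniteMeasure κ] : StronglyMeasurable fun u => ∫ t, f t u ∂κ :=
    hf.stronglyMeasurable.integral_prod_left
  have hGb (κ : Measure ℝ) [IsFiniteMeasure κ] (u : ℝ) : ‖∫ t, f t u ∂κ‖ ≤ C * κ.real univ :=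
    norm_integral_le_of_norm_le_const (ae_of_all _ fun t => hC t _)
  have hint (κ η : Measure ℝ) [IsFiniteMeasure κ] [IsFiniteMeasure η] :
      Integrable (fun u => (∫ s, f s u ∂κ) * (∫ t, f t u ∂η)) ρ := by
    refine Integrable.of_bound (C := (C * κ.real univ) * (C * η.real univ))
      ((hG κ).mul (hG η)).aestronglyMeasurable (ae_of_all _ fun u => ?_)
    rw [norm_mul]
    exact mul_le_mul (hGb κ u) (hGb η u) (norm_nonneg _) ((norm_nonneg _).trans (hGb κ u))
  rw [← integral_const_mul, ← integral_const_mul,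
    ← integral_sub ((hint ν μ).const_mul _) ((hint μ μ).const_mul _)]
  refine integral_mono (((hint ν μ).const_mul _).sub ((hint μ μ).const_mul _)) (hint ν ν)
    fun u => ?_
  simp only
  nlinarith [sq_nonneg ((∫ s, f s u ∂ν) - c * ∫ s, f s u ∂μ)]

/-- The bounded factor `s ↦ s^{-α} 1_{u < s}` (truncated below `a`) of the kernel
`min(s,t)/(st)^α`. -/
noncomputable def powerFactor (α a s u : ℝ) : ℝ :=
  if u < s then (max a s) ^ (-α) else 0

lemma measurable_powerFactor (α a : ℝ) : Measurable (Function.uncurry (powerFactor α a)) := by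
  unfold powerFactor Function.uncurry
  refine Measurable.ite (measurableSet_lt measurable_snd measurable_fst) ?_ measurable_const
  fun_prop

lemma abs_powerFactor_le {α a : ℝ} (hα : 0 ≤ α) (ha : 0 < a) (s u : ℝ) :
    |powerFactor α a s u| ≤ a ^ (-α) := by
  unfold powerFactor
  split_ifs
  · rw [abs_of_nonneg (rpow_nonneg (ha.le.trans (le_max_left _ _)) _)]
    exact rpow_le_rpow_of_nonpos ha (le_max_left _ _) (by linarith)
  · simpa using rpow_nonneg ha.le _

lemma integral_powerFactor_mul {α a b s t : ℝ} (ha : 0 < a) (hs : s ∈ Icc a b)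
    (ht : t ∈ Icc a b) :
    ∫ u, powerFactor α a s u * powerFactor α a t u ∂(volume.restrict (Ioc 0 b)) =
      min s t / (s * t) ^ α := by
  have hs0 : 0 < s := ha.trans_le hs.1
  have ht0 : 0 < t := ha.trans_le ht.1
  have hfun : (fun u => powerFactor α a s u * powerFactor α a t u) =
      (Iio (min s t)).indicator fun _ => s ^ (-α) * t ^ (-α) := by
    ext u
    unfold powerFactor
    rw [max_eq_right hs.1, max_eq_right ht.1]
    by_cases h1 : u < s <;> by_cases h2 : u < t <;> simp [h1, h2, indicator]
  have hset : Iio (min s t) ∩ Ioc 0 b = Ioo 0 (min s t) := by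
    ext u
    simp only [mem_inter_iff, mem_Iio, mem_Ioc, mem_Ioo]
    refine ⟨fun h => ⟨h.2.1, h.1⟩, fun h => ⟨h.2, h.1, ?_⟩⟩
    exact (h.2.trans_le (min_le_left _ _)).le.trans hs.2
  have hmin : 0 < min s t := lt_min hs0 ht0
  rw [hfun, integral_indicator measurableSet_Iio, Measure.restrict_restrict measurableSet_Iio,
    hset, setIntegral_const, measureReal_def, Real.volume_Ioo, sub_zero,
    ENNReal.toReal_ofReal hmin.le, mul_rpow hs0.le ht0.le, rpow_neg hs0.le, rpow_neg ht0.le,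
    smul_eq_mul, div_eq_mul_inv, mul_inv]

/-- The absolutely continuous part of the potential of the measure `μ_α`. -/
lemma setIntegral_density_mul_kernel {α a b t : ℝ} (hα : 0 < α ∧ α < 1) (ha : 0 < a)
    (ht : t ∈ Icc a b) :
    IntegrableOn (fun x => α * (1 - α) * x ^ (2 * α - 2) * (min t x / (t * x) ^ α)) (Icc a b) ∧
    ∫ x in Icc a b, α * (1 - α) * x ^ (2 * α - 2) * (min t x / (t * x) ^ α) =
      1 - (1 - α) * (a ^ α * t ^ (-α)) - α * (b ^ (α - 1) * t ^ (1 - α)) := by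
  have ht0 : 0 < t := ha.trans_le ht.1
  have hcont : ContinuousOn
      (fun x => α * (1 - α) * x ^ (2 * α - 2) * (min t x / (t * x) ^ α)) (Icc a b) := by
    have hpos : ∀ x ∈ Icc a b, 0 < x := fun x hx => ha.trans_le hx.1
    refine (continuousOn_const.mul (continuousOn_id.rpow_const fun x hx =>
      Or.inl (hpos x hx).ne')).mul (ContinuousOn.div (by fun_prop)
        (ContinuousOn.rpow_const (by fun_prop) fun x hx =>
          Or.inl (mul_pos ht0 (hpos x hx)).ne') fun x hx =>
            (rpow_pos_of_pos (mul_pos ht0 (hpos x hx)) _).ne')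
  have hint := hcont.integrableOn_Icc (μ := volume)
  refine ⟨hint, ?_⟩
  have hab : a ≤ b := ht.1.trans ht.2
  have hI : ∀ {c d : ℝ}, a ≤ c → c ≤ d → d ≤ b → IntervalIntegrable
      (fun x => α * (1 - α) * x ^ (2 * α - 2) * (min t x / (t * x) ^ α)) volume c d := by
    intro c d hc hcd hd
    refine ContinuousOn.intervalIntegrable (hcont.mono ?_)
    rw [uIcc_of_le hcd]
    exact Icc_subset_Icc hc hd
  rw [integral_Icc_eq_integral_Ioc, ← intervalIntegral.integral_of_le hab,
    ← intervalIntegral.integral_add_adjacent_intervals (hI le_rfl ht.1 ht.2)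
      (hI ht.1 ht.2 le_rfl)]
  have hleft : ∫ x in a..t, α * (1 - α) * x ^ (2 * α - 2) * (min t x / (t * x) ^ α) =
      ∫ x in a..t, α * (1 - α) * t ^ (-α) * x ^ (α - 1) := by
    refine intervalIntegral.integral_congr fun x hx => ?_
    rw [uIcc_of_le ht.1] at hx
    have hx0 : 0 < x := ha.trans_le hx.1
    have e : x ^ (α - 1) = x ^ (2 * α - 2) * x * x ^ (-α) := by
      rw [← rpow_add_one hx0.ne', ← rpow_add hx0]
      ring_nf
    rw [min_eq_right hx.2, mul_rpow ht0.le hx0.le, e, rpow_neg ht0.le, rpow_neg hx0.le,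
      div_eq_mul_inv, mul_inv]
    ring
  have hright : ∫ x in t..b, α * (1 - α) * x ^ (2 * α - 2) * (min t x / (t * x) ^ α) =
      ∫ x in t..b, α * (1 - α) * t ^ (1 - α) * x ^ (α - 2) := by
    refine intervalIntegral.integral_congr fun x hx => ?_
    rw [uIcc_of_le ht.2] at hx
    have hx0 : 0 < x := ht0.trans_le hx.1
    have e : x ^ (α - 2) = x ^ (2 * α - 2) * x ^ (-α) := by
      rw [← rpow_add hx0]
      ring_nf
    have e' : t ^ (1 - α) = t * t ^ (-α) := by
      rw [sub_eq_add_neg, rpow_add ht0, rpow_one]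
    rw [min_eq_left hx.1, mul_rpow ht0.le hx0.le, e, e', rpow_neg ht0.le, rpow_neg hx0.le,
      div_eq_mul_inv, mul_inv]
    ring
  have hnot : (0 : ℝ) ∉ uIcc t b := by
    rw [uIcc_of_le ht.2]
    exact fun h => (ht0.trans_le h.1).false
  rw [hleft, hright, intervalIntegral.integral_const_mul, intervalIntegral.integral_const_mul,
    integral_rpow (Or.inl (by linarith [hα.1])),
    integral_rpow (Or.inr ⟨by linarith [hα.2], hnot⟩)]
  have h1 : α - 1 + 1 = α := by ring
  have h2 : α - 2 + 1 = α - 1 := by ring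
  rw [h1, h2]
  have hα0 : α ≠ 0 := hα.1.ne'
  have hα1 : α - 1 ≠ 0 := by linarith [hα.2]
  have e1 : t ^ (-α) * t ^ α = 1 := by rw [← rpow_add ht0]; simp
  have e2 : t ^ (1 - α) * t ^ (α - 1) = 1 := by rw [← rpow_add ht0]; simp
  have k1 : α * (1 - α) * t ^ (-α) * ((t ^ α - a ^ α) / α) =
      (1 - α) * (t ^ (-α) * t ^ α) - (1 - α) * (a ^ α * t ^ (-α)) := by
    field_simp
  have k2 : α * (1 - α) * t ^ (1 - α) * ((b ^ (α - 1) - t ^ (α - 1)) / (α - 1)) =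
      α * (t ^ (1 - α) * t ^ (α - 1)) - α * (b ^ (α - 1) * t ^ (1 - α)) := by
    field_simp
    ring
  rw [k1, k2, e1, e2]
  ring

/-- The measure `μ_α` has constant potential `1` on `[a,b]`. -/
lemma potential_eq_one {α a b t : ℝ} (hα : 0 < α ∧ α < 1) (ha : 0 < a) (ht : t ∈ Icc a b) :
    ∫ x, min t x / (t * x) ^ α ∂((volume.restrict (Icc a b)).withDensity
          (fun x => ENNReal.ofReal (α * (1 - α) * x ^ (2 * α - 2)))
        + ENNReal.ofReal ((1 - α) * a ^ (2 * α - 1)) • Measure.dirac a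
        + ENNReal.ofReal (α * b ^ (2 * α - 1)) • Measure.dirac b) = 1 := by
  have ht0 : 0 < t := ha.trans_le ht.1
  have hb : 0 < b := ht0.trans_le ht.2
  have hα' : 0 < 1 - α := sub_pos.2 hα.2
  obtain ⟨hint, hval⟩ := setIntegral_density_mul_kernel hα ha ht
  have hmeas : Measurable fun x : ℝ => ENNReal.ofReal (α * (1 - α) * x ^ (2 * α - 2)) := by
    fun_prop
  have hlt : ∀ᵐ x ∂(volume.restrict (Icc a b)),
      ENNReal.ofReal (α * (1 - α) * x ^ (2 * α - 2)) < ⊤ := ae_of_all _ fun _ => by simp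
  have hpos : ∀ x ∈ Icc a b, (ENNReal.ofReal (α * (1 - α) * x ^ (2 * α - 2))).toReal •
      (min t x / (t * x) ^ α) = α * (1 - α) * x ^ (2 * α - 2) * (min t x / (t * x) ^ α) := by
    intro x hx
    have := rpow_nonneg (ha.le.trans hx.1) (2 * α - 2)
    have := hα.1
    rw [ENNReal.toReal_ofReal (by positivity), smul_eq_mul]
  have hI : Integrable (fun x => min t x / (t * x) ^ α) ((volume.restrict (Icc a b)).withDensity
      (fun x => ENNReal.ofReal (α * (1 - α) * x ^ (2 * α - 2)))) := by
    rw [integrable_withDensity_iff_integrable_smul' hmeas hlt]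
    exact hint.congr_fun (fun x hx => (hpos x hx).symm) measurableSet_Icc
  have hD (x : ℝ) (c : ℝ) : Integrable (fun x => min t x / (t * x) ^ α)
      (ENNReal.ofReal c • Measure.dirac x) :=
    (integrable_dirac (by simp)).smul_measure ENNReal.ofReal_ne_top
  rw [integral_add_measure (hI.add_measure (hD _ _)) (hD _ _), integral_add_measure hI (hD _ _),
    integral_withDensity_eq_integral_toReal_smul hmeas hlt,
    setIntegral_congr_fun measurableSet_Icc hpos, hval, integral_smul_measure,
    integral_smul_measure, integral_dirac, integral_dirac, min_eq_right ht.1, min_eq_left ht.2,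
    mul_rpow ht0.le ha.le, mul_rpow ht0.le hb.le, ENNReal.toReal_ofReal (by positivity),
    ENNReal.toReal_ofReal (mul_nonneg hα.1.le (by positivity))]
  have ea : a ^ (2 * α - 1) = a ^ α * a ^ α / a := by
    rw [rpow_sub_one ha.ne', two_mul, rpow_add ha]
  have eb : b ^ (2 * α - 1) = b ^ α * b ^ α / b := by
    rw [rpow_sub_one hb.ne', two_mul, rpow_add hb]
  have := (rpow_pos_of_pos ha α).ne'
  have := (rpow_pos_of_pos hb α).ne'
  have := (rpow_pos_of_pos ht0 α).ne'
  rw [ea, eb, rpow_sub_one hb.ne', rpow_sub ht0, rpow_one, rpow_neg ht0.le, smul_eq_mul,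
    smul_eq_mul]
  field_simp
  ring

/-- For `X(t) = t^{-α} B(t)` (with `B` standard Brownian motion), i.e. for
the covariance kernel `R(s,t) = min(s,t)/(st)^α` on `[a,b]`, `0 < a < b`, `0 < α < 1`,
the measure
`μ_α(dx) = α(1-α) x^{2α-2} dx + (1-α) a^{2α-1} δ_a(dx) + α b^{2α-1} δ_b(dx)`
is a constant multiple of an optimal measure: `μ_α/μ_α([a,b])` minimizes
`I(ν) = ∫∫ R(s,t) ν(ds) ν(dt)` over Borel probability measures on `[a,b]`. -/
theorem normalized_measure_optimal_for_power_normalized_BM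
    (α a b : ℝ) (hα : 0 < α ∧ α < 1) (hab : 0 < a ∧ a < b)
    (R : ℝ → ℝ → ℝ) (hR : ∀ s t, R s t = min s t / (s * t) ^ α)
    (μ : Measure ℝ)
    (hμ : μ = (volume.restrict (Icc a b)).withDensity
          (fun x => ENNReal.ofReal (α * (1 - α) * x ^ (2 * α - 2)))
        + ENNReal.ofReal ((1 - α) * a ^ (2 * α - 1)) • Measure.dirac a
        + ENNReal.ofReal (α * b ^ (2 * α - 1)) • Measure.dirac b) :
    IsProbabilityMeasure ((μ Set.univ)⁻¹ • μ) ∧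
    ((μ Set.univ)⁻¹ • μ) (Icc a b)ᶜ = 0 ∧
    (∀ ν : Measure ℝ, IsProbabilityMeasure ν → ν (Icc a b)ᶜ = 0 →
      kernelEnergy R ((μ Set.univ)⁻¹ • μ) ≤ kernelEnergy R ν) := by
  obtain ⟨ha, hab⟩ := hab
  have hb : 0 < b := ha.trans hab
  have hfin : IsFiniteMeasure μ := by
    have hc : IntegrableOn (fun x : ℝ => α * (1 - α) * x ^ (2 * α - 2)) (Icc a b) :=
      (continuousOn_const.mul (continuousOn_id.rpow_const fun x hx =>
        Or.inl (ha.trans_le hx.1).ne')).integrableOn_Icc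
    have := isFiniteMeasure_withDensity_ofReal hc.2
    have (x c : ℝ) : IsFiniteMeasure (ENNReal.ofReal c • Measure.dirac x) :=
      Measure.smul_finite _ ENNReal.ofReal_ne_top
    rw [hμ]
    infer_instance
  have hμ0 : NeZero μ := by
    refine ⟨fun h => ?_⟩
    have hle : ENNReal.ofReal (α * b ^ (2 * α - 1)) ≤ μ univ := by
      rw [hμ]
      simp
    rw [h] at hle
    have : 0 < α * b ^ (2 * α - 1) := mul_pos hα.1 (rpow_pos_of_pos hb _)
    simp [this.not_ge] at hle
  have hsupp : μ (Icc a b)ᶜ = 0 := by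
    have hac := withDensity_absolutelyContinuous (volume.restrict (Icc a b))
      (fun x => ENNReal.ofReal (α * (1 - α) * x ^ (2 * α - 2)))
    have h0 : (volume.restrict (Icc a b)) (Icc a b)ᶜ = 0 := by
      simp [Measure.restrict_apply measurableSet_Icc.compl]
    rw [hμ]
    simp [hac h0, hab.le]
  refine ⟨inferInstance, by simp [hsupp], fun ν hν hνs => ?_⟩
  have hpot : ∀ t ∈ Icc a b, ∫ x, R t x ∂μ = 1 := by
    intro t ht
    simp_rw [hR]
    rw [hμ]
    exact potential_eq_one hα ha ht
  have hmem (κ : Measure ℝ) (hκ : κ (Icc a b)ᶜ = 0) : ∀ᵐ s ∂κ, s ∈ Icc a b := hκ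
  have hrep (κ η : Measure ℝ) (hκ : κ (Icc a b)ᶜ = 0) (hη : η (Icc a b)ᶜ = 0) :
      ∫ s, ∫ t, ∫ u, powerFactor α a s u * powerFactor α a t u
        ∂(volume.restrict (Ioc 0 b)) ∂η ∂κ = ∫ s, ∫ t, R s t ∂η ∂κ := by
    refine integral_congr_ae ((hmem κ hκ).mono fun s hs => ?_)
    refine integral_congr_ae ((hmem η hη).mono fun t ht => ?_)
    simp only
    rw [hR, integral_powerFactor_mul ha hs ht]
  have hcross (κ : Measure ℝ) (hκ : κ (Icc a b)ᶜ = 0) :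
      ∫ s, ∫ t, R s t ∂μ ∂κ = κ.real univ := by
    rw [integral_congr_ae ((hmem κ hκ).mono fun s hs => hpot s hs)]
    simp
  have key := factored_kernel_energy_ge (measurable_powerFactor α a)
    (abs_powerFactor_le hα.1.le ha) (volume.restrict (Ioc 0 b)) μ ν (μ.real univ)⁻¹
  rw [hrep _ _ hνs hsupp, hrep _ _ hsupp hsupp, hrep _ _ hνs hνs, hcross ν hνs, hcross μ hsupp,
    probReal_univ (μ := ν)] at key
  have hM : μ.real univ ≠ 0 := by simpa [measureReal_def, ENNReal.toReal_eq_zero_iff] using hμ0.out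
  have hself : kernelEnergy R ((μ univ)⁻¹ • μ) = (μ.real univ)⁻¹ := by
    unfold kernelEnergy
    simp_rw [integral_smul_measure]
    rw [integral_smul, hcross μ hsupp, ENNReal.toReal_inv, ← measureReal_def]
    simp [hM]
  rw [hself]
  refine le_trans (le_of_eq ?_) key
  field_simp
  ring
end

section
/- Let (B(t), t ≥ 0) be standard Brownian motion, fix 0 < α < 1 and 0 < a < b < ∞, let X(t) = t^{−α} B(t) and X_* = min_{t∈[a,b]} X(t). Let μ_α(dx) = α(1−α) x^{2α−2} dx + (1−α) a^{2α−1} δ_a(dx) + α b^{2α−1} δ_b(dx), and set σ*²(a,b;α) = μ_α([a,b])^{−2} Var( ∫_a^b X(t) μ_α(dt) ). Then liminf_{u→∞} u^{−2/3} ( log P(X_* > u) + u²/(2σ*²(a,b;α)) ) > −∞ and limsup_{u→∞} u^{−2/3} ( log P(X_* > u) + u²/(2σ*²(a,b;α)) ) < 0. -/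
open MeasureTheory ProbabilityTheory Filter Set Real

section HighMinima

open scoped NNReal ENNReal

theorem lintegral_gaussianReal_eq (m : ℝ) {v : ℝ≥0} (hv : v ≠ 0) {G : ℝ → ℝ≥0∞}
    (hG : Measurable G) :
    ∫⁻ z, G z ∂gaussianReal m v = ∫⁻ z, ENNReal.ofReal (gaussianPDFReal m v z) * G z := by
  rw [gaussianReal_of_var_ne_zero _ hv,
    lintegral_withDensity_eq_lintegral_mul _ (measurable_gaussianPDF m v) hG]
  rfl

/-- One-dimensional Cameron–Martin formula. -/
theorem lintegral_exp_mul_gaussianReal (v : ℝ≥0) (θ x : ℝ) {G : ℝ → ℝ≥0∞} (hG : Measurable G) :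
    ∫⁻ z, ENNReal.ofReal (exp (θ * (x + z - θ * v))) * G (x + z - θ * v) ∂gaussianReal 0 v =
      ENNReal.ofReal (exp (θ * x - θ ^ 2 * v / 2)) * ∫⁻ z, G (x + z) ∂gaussianReal 0 v := by
  rcases eq_or_ne v 0 with rfl | hv
  · simp [gaussianReal_zero_var, lintegral_dirac]
  have h1 : ∫⁻ z, ENNReal.ofReal (exp (θ * (x + z - θ * v))) * G (x + z - θ * v)
        ∂gaussianReal 0 v =
      ∫⁻ y, ENNReal.ofReal (exp (θ * (x + y))) * G (x + y) ∂gaussianReal (0 - θ * v) v := by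
    rw [← gaussianReal_map_sub_const, lintegral_map (by fun_prop) (by fun_prop)]
    simp only [add_sub_assoc]
  rw [h1, lintegral_gaussianReal_eq _ hv (by fun_prop), lintegral_gaussianReal_eq _ hv (by fun_prop),
    ← lintegral_const_mul _ (by fun_prop)]
  refine lintegral_congr fun y => ?_
  rw [← mul_assoc, ← mul_assoc, ← ENNReal.ofReal_mul (gaussianPDFReal_nonneg _ _ _),
    ← ENNReal.ofReal_mul (exp_nonneg _)]
  congr 2
  have hv' : (v : ℝ) ≠ 0 := by exact_mod_cast hv
  simp only [gaussianPDFReal]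
  rw [mul_assoc, ← exp_add, mul_left_comm, ← exp_add]
  congr 2
  field_simp
  ring

/-- A Gaussian bump transforms explicitly under Gaussian convolution; only the lower bound
is needed. -/
theorem integral_exp_neg_sq_gaussianReal {k : ℝ} (hk : 0 ≤ k) (v : ℝ≥0) (x : ℝ) :
    ∫ z, exp (-k * (x + z) ^ 2 / 2) ∂gaussianReal 0 v =
      (√(1 + k * v))⁻¹ * exp (-k * x ^ 2 / (2 * (1 + k * v))) := by
  rcases eq_or_ne v 0 with rfl | hv
  · simp [gaussianReal_zero_var]
  have hv' : (0 : ℝ) < v := by exact_mod_cast pos_of_ne_zero hv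
  have hp : 0 < 1 + k * (v : ℝ) := by positivity
  set w : ℝ≥0 := ⟨v / (1 + k * v), by positivity⟩ with hw
  have hwv : (w : ℝ) = v / (1 + k * v) := rfl
  have hw0 : w ≠ 0 := by
    have : (w : ℝ) ≠ 0 := by rw [hwv]; positivity
    exact_mod_cast this
  rw [integral_gaussianReal_eq_integral_smul hv]
  have : ∀ z, gaussianPDFReal 0 v z • exp (-k * (x + z) ^ 2 / 2) =
      ((√(1 + k * v))⁻¹ * exp (-k * x ^ 2 / (2 * (1 + k * v)))) *
        gaussianPDFReal (-(k * v * x / (1 + k * v))) w z := by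
    intro z
    have hs : √(2 * π * v) = √(1 + k * v) * √(2 * π * w) := by
      rw [← Real.sqrt_mul hp.le, hwv]
      congr 1
      field_simp
    simp only [gaussianPDFReal, smul_eq_mul, hs]
    rw [mul_assoc, ← exp_add, mul_inv, mul_mul_mul_comm, ← exp_add]
    congr 2
    rw [hwv]
    field_simp
    ring
  simp_rw [this]
  rw [integral_const_mul, integral_gaussianPDFReal_eq_one _ hw0, mul_one]

/-- A bump supported in `[-1, 1]` which is nearly superharmonic up to an exponential rate. -/
noncomputable def bump (y : ℝ) : ℝ := exp (-2 * y ^ 2) - exp (-2)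

theorem bump_nonpos {y : ℝ} (hy : 1 ≤ |y|) : bump y ≤ 0 := by
  have : 1 ≤ y ^ 2 := by rw [← sq_abs]; nlinarith
  have := exp_le_exp.2 (show -2 * y ^ 2 ≤ -2 by linarith)
  unfold bump; linarith

theorem bump_le_one (y : ℝ) : bump y ≤ 1 := by
  have := exp_le_one_iff.2 (show -2 * y ^ 2 ≤ 0 by nlinarith [sq_nonneg y])
  unfold bump; linarith [exp_pos (-2)]

@[fun_prop]
theorem measurable_bump : Measurable bump := by unfold bump; fun_prop

theorem abs_bump_le (y : ℝ) : |bump y| ≤ 1 := by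
  refine abs_le.2 ⟨?_, bump_le_one y⟩
  have : exp (-2) ≤ 1 := exp_le_one_iff.2 (by norm_num)
  unfold bump; linarith [exp_pos (-2 * y ^ 2)]

theorem bump_integral_ge {v : ℝ≥0} (hv : v ≤ 1 / 4) {x : ℝ} (hx : |x| ≤ 1) :
    (1 - 3 * v) * bump x ≤ ∫ z, bump (x + z) ∂gaussianReal 0 v := by
  have hv' : (v : ℝ) ≤ 1 / 4 := by exact_mod_cast hv
  have hv0 : (0 : ℝ) ≤ v := v.2
  have hx2 : x ^ 2 ≤ 1 := by rw [← sq_abs]; nlinarith [abs_nonneg x]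
  have e1 : ∫ z, bump (x + z) ∂gaussianReal 0 v =
      (√(1 + 4 * v))⁻¹ * exp (-4 * x ^ 2 / (2 * (1 + 4 * v))) - exp (-2) := by
    rw [← integral_exp_neg_sq_gaussianReal (by norm_num : (0 : ℝ) ≤ 4)]
    simp only [bump]
    rw [integral_sub]
    · simp only [integral_const, probReal_univ, smul_eq_mul, one_mul]
      congr 1
      refine integral_congr_ae (.of_forall fun z => ?_)
      simp only
      congr 1
      ring
    · refine Integrable.of_bound (C := 1) (by fun_prop) (.of_forall fun z => ?_)
      rw [norm_of_nonneg (exp_nonneg _)]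
      exact exp_le_one_iff.2 (by nlinarith [sq_nonneg (x + z)])
    · exact integrable_const _
  rw [e1]
  have h1 : exp (-2 * v) ≤ (√(1 + 4 * v))⁻¹ := by
    rw [show (-2 * v : ℝ) = -(2 * v) by ring, exp_neg]
    refine inv_anti₀ (by positivity) ?_
    rw [Real.sqrt_le_left (by positivity), ← exp_nat_mul]
    have := add_one_le_exp (4 * v : ℝ)
    calc 1 + 4 * (v : ℝ) ≤ exp (4 * v) := by linarith
      _ = _ := by congr 1; push_cast; ring
  have h2 : exp (-2 * x ^ 2) * (1 - 2 * v + 4 * v * x ^ 2) ≤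
      (√(1 + 4 * v))⁻¹ * exp (-4 * x ^ 2 / (2 * (1 + 4 * v))) := by
    calc exp (-2 * x ^ 2) * (1 - 2 * v + 4 * v * x ^ 2)
        ≤ exp (-2 * x ^ 2) * exp (- 2 * v + 4 * v * x ^ 2) := by
          gcongr
          linarith [add_one_le_exp (- 2 * v + 4 * v * x ^ 2)]
      _ = exp (-2 * v) * exp (-2 * x ^ 2 + 4 * v * x ^ 2) := by
          rw [← exp_add, ← exp_add]; congr 1; ring
      _ ≤ (√(1 + 4 * v))⁻¹ * exp (-4 * x ^ 2 / (2 * (1 + 4 * v))) := by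
          gcongr
          rw [le_div_iff₀ (by positivity)]
          nlinarith [mul_nonneg hv0 (sq_nonneg x), mul_nonneg (mul_nonneg hv0 hv0) (sq_nonneg x)]
  have h3 : exp (-2) * (3 - 2 * x ^ 2) ≤ exp (-2 * x ^ 2) := by
    calc exp (-2) * (3 - 2 * x ^ 2) ≤ exp (-2) * exp (2 - 2 * x ^ 2) := by
          gcongr
          linarith [add_one_le_exp (2 - 2 * x ^ 2)]
      _ = _ := by rw [← exp_add]; congr 1; ring
  have h4 : 3 * exp (-2) ≤ exp (-2 * x ^ 2) * (1 + 4 * x ^ 2) := by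
    have h5 : 0 ≤ exp (-2) * (x ^ 2 * (10 - 8 * x ^ 2)) := by
      have : 0 ≤ x ^ 2 * (10 - 8 * x ^ 2) := mul_nonneg (sq_nonneg x) (by linarith)
      positivity
    nlinarith [mul_le_mul_of_nonneg_right h3 (show 0 ≤ 1 + 4 * x ^ 2 by positivity)]
  unfold bump
  nlinarith [mul_le_mul_of_nonneg_left h4 hv0]

theorem bump_lintegral_ge {v : ℝ≥0} {m : ℝ} (hm : 0 < m) (hv : v ≤ m ^ 2 / 4) (x : ℝ) :
    ENNReal.ofReal (1 - 3 * (v / m ^ 2)) * ENNReal.ofReal (bump (x / m - 1)) ≤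
      ∫⁻ z, ENNReal.ofReal (bump ((x + z) / m - 1)) ∂gaussianReal 0 v := by
  rcases le_or_gt 1 |x / m - 1| with h | h
  · rw [ENNReal.ofReal_of_nonpos (bump_nonpos h), mul_zero]
    exact zero_le
  set w : ℝ≥0 := ⟨v / m ^ 2, by positivity⟩ with hw
  have hwv : (w : ℝ) = v / m ^ 2 := rfl
  have hw4 : w ≤ 1 / 4 := by
    rw [← NNReal.coe_le_coe, hwv, div_le_iff₀ (by positivity)]
    push_cast
    linarith
  have e : (gaussianReal 0 v).map (fun z => z / m) = gaussianReal 0 w := by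
    rw [gaussianReal_map_div_const, zero_div]
    congr 1
  have e2 : ∫⁻ z, ENNReal.ofReal (bump ((x + z) / m - 1)) ∂gaussianReal 0 v =
      ∫⁻ z, ENNReal.ofReal (bump ((x / m - 1) + z)) ∂gaussianReal 0 w := by
    rw [← e, lintegral_map (by fun_prop) (by fun_prop)]
    refine lintegral_congr fun z => ?_
    congr 2
    ring
  rw [e2, ← hwv, ← ENNReal.ofReal_mul (by
    have : (w : ℝ) ≤ 1 / 4 := by exact_mod_cast hw4
    linarith)]
  refine (ENNReal.ofReal_le_ofReal (bump_integral_ge hw4 h.le)).trans ?_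
  have hi : Integrable (fun z => bump ((x / m - 1) + z)) (gaussianReal 0 w) :=
    Integrable.of_bound (C := 1) (Measurable.aestronglyMeasurable (by fun_prop))
      (.of_forall fun z => abs_bump_le _)
  rw [integral_eq_lintegral_pos_part_sub_lintegral_neg_part hi]
  refine (ENNReal.ofReal_le_ofReal (sub_le_self _ ENNReal.toReal_nonneg)).trans ?_
  exact ENNReal.ofReal_toReal_le

/-- A discounted half-Gaussian has mass bounded away from `1`. -/
theorem lintegral_exp_neg_Ioi_le {v : ℝ≥0} {κ x : ℝ} (hκ : 0 ≤ κ) (hx : 0 ≤ x) :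
    ∫⁻ z, (Ioi 0).indicator (fun y => ENNReal.ofReal (exp (-κ * y))) (x + z) ∂gaussianReal 0 v ≤
      ENNReal.ofReal (1 - (gaussianReal 0 1).real (Ici 1) * (1 - exp (-(κ * √v)))) := by
  have e : (gaussianReal 0 1).map (fun z => √v * z) = gaussianReal 0 v := by
    rw [gaussianReal_map_const_mul, mul_zero, mul_one]
    congr 1
    ext
    simp
  have hq0 : 0 ≤ 1 - exp (-(κ * √v)) := by
    have := exp_le_one_iff.2 (show -(κ * √v) ≤ 0 by simp; positivity)
    linarith
  have hq1 : exp (-(κ * √v)) > 0 := exp_pos _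
  rw [← e, lintegral_map (by
    refine Measurable.comp (g := (Ioi (0 : ℝ)).indicator _) ?_ (by fun_prop)
    exact Measurable.indicator (by fun_prop) measurableSet_Ioi) (by fun_prop)]
  calc _ ≤ ∫⁻ z, ENNReal.ofReal (1 - (Ici (1 : ℝ)).indicator (fun _ => 1 - exp (-(κ * √v))) z)
          ∂gaussianReal 0 1 := by
        refine lintegral_mono fun z => ?_
        by_cases hz : z ∈ Ici (1 : ℝ)
        · have hz' : 1 ≤ z := hz
          rw [indicator_of_mem hz, sub_sub_cancel]
          refine (indicator_le_self _ _ _).trans ?_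
          refine ENNReal.ofReal_le_ofReal (exp_le_exp.2 ?_)
          nlinarith [mul_nonneg hκ hx, mul_le_mul_of_nonneg_left hz'
            (mul_nonneg hκ (Real.sqrt_nonneg v))]
        · rw [indicator_of_notMem hz, sub_zero, ENNReal.ofReal_one]
          by_cases hy : x + √v * z ∈ Ioi (0 : ℝ)
          · rw [indicator_of_mem hy, ENNReal.ofReal_le_one, exp_le_one_iff]
            nlinarith [mul_nonneg hκ (le_of_lt (mem_Ioi.1 hy))]
          · rw [indicator_of_notMem hy]
            exact zero_le
    _ = _ := by
        rw [← ofReal_integral_eq_lintegral_ofReal]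
        · congr 1
          rw [integral_sub (integrable_const _)
            ((integrable_const _).indicator measurableSet_Ici),
            integral_indicator_const _ measurableSet_Ici]
          simp
        · exact (integrable_const _).sub ((integrable_const _).indicator measurableSet_Ici)
        · refine .of_forall fun z => ?_
          simp only [Pi.zero_apply, indicator]
          split_ifs <;> linarith

section Walk

variable {Ω : Type*} {mΩ : MeasurableSpace Ω} {P : Measure Ω} {B : ℝ≥0 → Ω → ℝ}

/-- The expectation of `ψ` of the height above the barrier `ℓ` at time `τ j`, on the event that
`B` has stayed above the barrier at the times `τ 0, …, τ j`. -/
noncomputable def aliveMass (B : ℝ≥0 → Ω → ℝ) (P : Measure Ω) (τ : ℕ → ℝ≥0) (ℓ : ℕ → ℝ) (j : ℕ)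
    (ψ : ℝ → ℝ≥0∞) : ℝ≥0∞ :=
  ∫⁻ ω, {ω | ∀ i ≤ j, ℓ i < B (τ i) ω}.indicator (fun ω => ψ (B (τ j) ω - ℓ j)) ω ∂P

theorem aliveMass_succ (hB : IsPreBrownianReal B P) {τ : ℕ → ℝ≥0} (hτ : Monotone τ) (ℓ : ℕ → ℝ)
    (j : ℕ) {ψ : ℝ → ℝ≥0∞} (hψ : Measurable ψ) :
    aliveMass B P τ ℓ (j + 1) ψ = aliveMass B P τ ℓ j (fun x =>
      ∫⁻ z, (Ioi 0).indicator ψ (x + z - (ℓ (j + 1) - ℓ j))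
        ∂gaussianReal 0 (τ (j + 1) - τ j)) := by
  have := hB.isGaussianProcess.isProbabilityMeasure
  set Z : Ω → ℝ := fun ω => B (τ (j + 1)) ω - B (τ j) ω with hZ
  set U : Ω → (Fin (j + 1) → ℝ) := fun ω i => B (τ i) ω with hU
  have hUm : AEMeasurable U P := aemeasurable_pi_lambda _ fun i => hB.aemeasurable _
  have hadd : τ j + (τ (j + 1) - τ j) = τ (j + 1) := add_tsub_cancel_of_le (hτ j.le_succ)
  have hZlaw : HasLaw Z (gaussianReal 0 (τ (j + 1) - τ j)) P := by
    have := (hB.shift (τ j)).hasLaw_eval (τ (j + 1) - τ j)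
    rwa [hadd] at this
  have hind : IndepFun U Z P := by
    have h := (hB.indepFun_shift (τ j)).symm
    have hm : Measurable fun q : ℝ≥0 → ℝ => q (τ (j + 1) - τ j) := measurable_pi_apply _
    have h2 := h.comp (φ := fun (p : Iic (τ j) → ℝ) (i : Fin (j + 1)) =>
      p ⟨τ i, hτ (Nat.lt_succ_iff.1 i.2)⟩) (by fun_prop) hm
    convert h2 using 1
    · rfl
    · funext ω
      simp only [hZ, Function.comp_def, hadd]
  set S : Set (Fin (j + 1) → ℝ) := {u | ∀ i : Fin (j + 1), ℓ i < u i} with hS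
  have hSm : MeasurableSet S := by
    have : S = ⋂ i, (fun u : Fin (j + 1) → ℝ => u i) ⁻¹' Ioi (ℓ i) := by ext; simp [hS]
    rw [this]
    exact MeasurableSet.iInter fun i => measurable_pi_apply i measurableSet_Ioi
  have hUS : ∀ ω, U ω ∈ S ↔ ∀ i ≤ j, ℓ i < B (τ i) ω := by
    intro ω
    simp only [hS, hU, mem_ofPred_eq]
    exact ⟨fun h i hi => h ⟨i, Nat.lt_succ_iff.2 hi⟩, fun h i => h i (Nat.lt_succ_iff.1 i.2)⟩
  have hψ' : Measurable ((Ioi (0 : ℝ)).indicator ψ) := hψ.indicator measurableSet_Ioi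
  set F : (Fin (j + 1) → ℝ) × ℝ → ℝ≥0∞ := fun p => S.indicator 1 p.1 *
    (Ioi 0).indicator ψ (p.1 (Fin.last j) - ℓ j + p.2 - (ℓ (j + 1) - ℓ j)) with hF
  have hFm : Measurable F := by
    refine Measurable.mul ?_ ?_
    · exact (measurable_one.indicator hSm).comp measurable_fst
    · exact hψ'.comp (by fun_prop)
  have hlaw : P.map (fun ω => (U ω, Z ω)) =
      (P.map U).prod (gaussianReal 0 (τ (j + 1) - τ j)) := by
    rw [(indepFun_iff_map_prod_eq_prod_map_map hUm hZlaw.aemeasurable).1 hind, hZlaw.map_eq]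
  calc aliveMass B P τ ℓ (j + 1) ψ = ∫⁻ ω, F (U ω, Z ω) ∂P := by
        refine lintegral_congr fun ω => ?_
        have e : U ω (Fin.last j) - ℓ j + Z ω - (ℓ (j + 1) - ℓ j) =
            B (τ (j + 1)) ω - ℓ (j + 1) := by simp only [hU, hZ, Fin.val_last]; ring
        have hmem : ω ∈ {ω | ∀ i ≤ j + 1, ℓ i < B (τ i) ω} ↔
            U ω ∈ S ∧ B (τ (j + 1)) ω - ℓ (j + 1) ∈ Ioi 0 := by
          rw [hUS, mem_Ioi, sub_pos]
          refine ⟨fun h => ⟨fun i hi => h i (by omega), h _ le_rfl⟩, fun h i hi => ?_⟩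
          rcases Nat.le_succ_iff.1 hi with h' | h'
          · exact h.1 i h'
          · rw [h']; exact h.2
        simp only [hF, e]
        by_cases h : ω ∈ {ω | ∀ i ≤ j + 1, ℓ i < B (τ i) ω}
        · obtain ⟨h1, h2⟩ := hmem.1 h
          rw [indicator_of_mem h, indicator_of_mem h1, indicator_of_mem h2, Pi.one_apply, one_mul]
        · rw [indicator_of_notMem h]
          rcases not_and_or.1 fun hh => h (hmem.2 hh) with h1 | h1
          · rw [indicator_of_notMem h1, zero_mul]
          · rw [indicator_of_notMem h1, mul_zero]
    _ = ∫⁻ p, F p ∂(P.map (fun ω => (U ω, Z ω))) := by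
        rw [lintegral_map' hFm.aemeasurable (hUm.prodMk hZlaw.aemeasurable)]
    _ = ∫⁻ ω, ∫⁻ z, F (U ω, z) ∂gaussianReal 0 (τ (j + 1) - τ j) ∂P := by
        rw [hlaw, lintegral_prod _ hFm.aemeasurable,
          lintegral_map' hFm.lintegral_prod_right'.aemeasurable hUm]
    _ = _ := by
        refine lintegral_congr fun ω => ?_
        simp only [hF]
        have hm : Measurable fun z => (Ioi (0 : ℝ)).indicator ψ
            (U ω (Fin.last j) - ℓ j + z - (ℓ (j + 1) - ℓ j)) := hψ'.comp (by fun_prop)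
        rw [lintegral_const_mul _ hm]
        simp only [indicator, mem_ofPred_eq, hUS, Pi.one_apply]
        split_ifs <;> simp [hU]

theorem aliveMass_succ_le (hB : IsPreBrownianReal B P) {τ : ℕ → ℝ≥0} (hτ : Monotone τ) {ℓ : ℕ → ℝ}
    {j : ℕ} {ψ φ : ℝ → ℝ≥0∞} (hψ : Measurable ψ) {C : ℝ}
    (h : ∀ x, 0 < x → ∫⁻ z, (Ioi 0).indicator ψ (x + z - (ℓ (j + 1) - ℓ j))
        ∂gaussianReal 0 (τ (j + 1) - τ j) ≤ ENNReal.ofReal C * φ x) :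
    aliveMass B P τ ℓ (j + 1) ψ ≤ ENNReal.ofReal C * aliveMass B P τ ℓ j φ := by
  rw [aliveMass_succ hB hτ ℓ j hψ, aliveMass, aliveMass,
    ← lintegral_const_mul' _ _ ENNReal.ofReal_ne_top]
  refine lintegral_mono fun ω => ?_
  simp only [indicator, mem_ofPred_eq]
  split_ifs with hω
  · exact h _ (sub_pos.2 (hω j le_rfl))
  · simp

theorem le_aliveMass_succ (hB : IsPreBrownianReal B P) {τ : ℕ → ℝ≥0} (hτ : Monotone τ) {ℓ : ℕ → ℝ}
    {j : ℕ} {ψ φ : ℝ → ℝ≥0∞} (hψ : Measurable ψ) {C : ℝ}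
    (h : ∀ x, 0 < x → ENNReal.ofReal C * φ x ≤
      ∫⁻ z, (Ioi 0).indicator ψ (x + z - (ℓ (j + 1) - ℓ j))
        ∂gaussianReal 0 (τ (j + 1) - τ j)) :
    ENNReal.ofReal C * aliveMass B P τ ℓ j φ ≤ aliveMass B P τ ℓ (j + 1) ψ := by
  rw [aliveMass_succ hB hτ ℓ j hψ, aliveMass, aliveMass,
    ← lintegral_const_mul' _ _ ENNReal.ofReal_ne_top]
  refine lintegral_mono fun ω => ?_
  simp only [indicator, mem_ofPred_eq]
  split_ifs with hω
  · exact h _ (sub_pos.2 (hω j le_rfl))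
  · simp

theorem aliveMass_zero (hB : IsPreBrownianReal B P) (τ : ℕ → ℝ≥0) (ℓ : ℕ → ℝ)
    {ψ : ℝ → ℝ≥0∞} (hψ : Measurable ψ) :
    aliveMass B P τ ℓ 0 ψ = ∫⁻ z, (Ioi 0).indicator ψ (z - ℓ 0) ∂gaussianReal 0 (τ 0) := by
  have hm : Measurable fun z => (Ioi (0 : ℝ)).indicator ψ (z - ℓ 0) :=
    (hψ.indicator measurableSet_Ioi).comp (by fun_prop)
  rw [← (hB.hasLaw_eval (τ 0)).map_eq, lintegral_map' hm.aemeasurable (hB.aemeasurable _)]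
  refine lintegral_congr fun ω => ?_
  simp [indicator]

theorem aliveMass_one_eq (hB : IsPreBrownianReal B P) (τ : ℕ → ℝ≥0) (ℓ : ℕ → ℝ) (n : ℕ) :
    aliveMass B P τ ℓ n 1 = P {ω | ∀ i ≤ n, ℓ i < B (τ i) ω} := by
  rw [aliveMass, ← lintegral_indicator_one₀]
  · rfl
  · have : {ω | ∀ i ≤ n, ℓ i < B (τ i) ω} = ⋂ i, ⋂ (_ : i ≤ n), {ω | ℓ i < B (τ i) ω} := by
      ext; simp
    rw [this]
    exact .iInter fun i => .iInter fun _ => nullMeasurableSet_lt aemeasurable_const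
      (hB.aemeasurable _)

end Walk

section WalkBounds

variable {Ω : Type*} {mΩ : MeasurableSpace Ω} {P : Measure Ω} {B : ℝ≥0 → Ω → ℝ}

/-- The energy of the piecewise linear path with slope `θ 0` on `[0, a]` and slopes
`θ 1, …, θ j` on the following intervals of length `h`. -/
noncomputable def pathEnergy (a h : ℝ≥0) (θ : ℕ → ℝ) (j : ℕ) : ℝ :=
  θ 0 ^ 2 * a + ∑ k ∈ Finset.range j, θ (k + 1) ^ 2 * h

theorem pathEnergy_succ (a h : ℝ≥0) (θ : ℕ → ℝ) (j : ℕ) :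
    pathEnergy a h θ (j + 1) = pathEnergy a h θ j + θ (j + 1) ^ 2 * h := by
  rw [pathEnergy, pathEnergy, Finset.sum_range_succ, add_assoc]

theorem measurable_ofReal_exp_mul (c : ℝ) :
    Measurable fun x : ℝ => ENNReal.ofReal (exp (c * x)) := by fun_prop

theorem aliveMass_exp_le (hB : IsPreBrownianReal B P) {a h : ℝ≥0} {τ : ℕ → ℝ≥0} {θ ℓ : ℕ → ℝ}
    (hτ : ∀ k, τ k = a + k * h) (hℓ0 : ℓ 0 = θ 0 * a)
    (hℓ : ∀ k, ℓ (k + 1) - ℓ k = θ (k + 1) * h) {n : ℕ} {κ : ℝ} (hκ : 0 ≤ κ)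
    (hθ0 : θ 1 ≤ θ 0) (hθ : ∀ k < n, κ ≤ θ (k + 1) - θ (k + 2)) {j : ℕ} (hj : j ≤ n) :
    aliveMass B P τ ℓ j (fun x => ENNReal.ofReal (exp (θ (j + 1) * x))) ≤
      ENNReal.ofReal (exp (-pathEnergy a h θ j / 2) *
        (1 - (gaussianReal 0 1).real (Ici 1) * (1 - exp (-(κ * √h)))) ^ j) := by
  have hmono : Monotone τ := by
    refine monotone_nat_of_le_succ fun k => ?_
    rw [hτ, hτ]; gcongr; simp
  set q := 1 - (gaussianReal 0 1).real (Ici 1) * (1 - exp (-(κ * √h))) with hq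
  have hq0 : 0 ≤ q := by
    have h1 : (gaussianReal 0 1).real (Ici 1) ≤ 1 := measureReal_le_one
    have h2 := exp_pos (-(κ * √h))
    have h3 : 0 ≤ (gaussianReal 0 1).real (Ici 1) := measureReal_nonneg
    have h4 := exp_le_one_iff.2 (show -(κ * √h) ≤ 0 by simp; positivity)
    rw [hq]; nlinarith
  induction j with
  | zero =>
    rw [aliveMass_zero hB _ _ (measurable_ofReal_exp_mul _)]
    have h0 : τ 0 = a := by simp [hτ]
    have key := lintegral_exp_mul_gaussianReal a (θ 0) 0 (G := fun _ => 1) measurable_const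
    rw [h0, hℓ0]
    calc _ ≤ ∫⁻ z, ENNReal.ofReal (exp (θ 0 * (0 + z - θ 0 * a))) * 1 ∂gaussianReal 0 a := by
          refine lintegral_mono fun z => ?_
          simp only [indicator]
          split_ifs with hz
          · simp only [mul_one, zero_add]
            refine ENNReal.ofReal_le_ofReal (exp_le_exp.2 ?_)
            exact mul_le_mul_of_nonneg_right hθ0 (le_of_lt hz)
          · exact zero_le
      _ = _ := by
          rw [key]
          simp [pathEnergy, neg_div]
  | succ j ih =>
    have hstep := aliveMass_succ_le (ℓ := ℓ) hB hmono (j := j)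
      (measurable_ofReal_exp_mul (θ (j + 1 + 1)))
      (C := exp (-(θ (j + 1) ^ 2 * h) / 2) * q)
      (φ := fun x => ENNReal.ofReal (exp (θ (j + 1) * x))) ?_
    · refine hstep.trans ((mul_le_mul_right (ih (by omega)) _).trans_eq ?_)
      rw [← ENNReal.ofReal_mul (by positivity), pathEnergy_succ]
      congr 1
      rw [show -(pathEnergy a h θ j + θ (j + 1) ^ 2 * h) / 2 =
        -(θ (j + 1) ^ 2 * h) / 2 + -pathEnergy a h θ j / 2 by ring, exp_add]
      ring
    · intro x hx
      have hd : τ (j + 1) - τ j = h := by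
        rw [hτ, hτ]; push_cast; rw [add_mul, one_mul, ← add_assoc]; exact add_tsub_cancel_left _ _
      have hGm : Measurable ((Ioi (0 : ℝ)).indicator (fun y => ENNReal.ofReal (exp (-κ * y)))) :=
        Measurable.indicator (by fun_prop) measurableSet_Ioi
      rw [hd, hℓ]
      calc _ ≤ ∫⁻ z, ENNReal.ofReal (exp (θ (j + 1) * (x + z - θ (j + 1) * h))) *
            (Ioi 0).indicator (fun y => ENNReal.ofReal (exp (-κ * y))) (x + z - θ (j + 1) * h)
            ∂gaussianReal 0 h := by
            refine lintegral_mono fun z => ?_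
            simp only [indicator]
            split_ifs with hz
            · rw [← ENNReal.ofReal_mul (exp_nonneg _), ← exp_add]
              refine ENNReal.ofReal_le_ofReal (exp_le_exp.2 ?_)
              nlinarith [mul_le_mul_of_nonneg_right (hθ j (by omega)) (le_of_lt (mem_Ioi.1 hz))]
            · exact zero_le
        _ ≤ ENNReal.ofReal (exp (θ (j + 1) * x - θ (j + 1) ^ 2 * h / 2)) *
            ENNReal.ofReal q := by
            rw [lintegral_exp_mul_gaussianReal _ _ _ hGm]
            gcongr
            exact lintegral_exp_neg_Ioi_le hκ hx.le
        _ = _ := by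
            rw [← ENNReal.ofReal_mul (exp_nonneg _), ← ENNReal.ofReal_mul (by positivity)]
            congr 1
            rw [show θ (j + 1) * x - θ (j + 1) ^ 2 * h / 2 =
              -(θ (j + 1) ^ 2 * h) / 2 + θ (j + 1) * x by ring, exp_add]
            ring

theorem exp_mul_bump_le_indicator {θ θ' m : ℝ} (hm : 0 < m) (hθ : θ' ≤ θ) (y : ℝ) :
    ENNReal.ofReal (exp (-(θ - θ') * (2 * m))) *
        (ENNReal.ofReal (exp (θ * y)) * ENNReal.ofReal (bump (y / m - 1))) ≤
      (Ioi 0).indicator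
        (fun y => ENNReal.ofReal (exp (θ' * y)) * ENNReal.ofReal (bump (y / m - 1))) y := by
  rcases le_or_gt 1 |y / m - 1| with h | h
  · rw [ENNReal.ofReal_of_nonpos (bump_nonpos h), mul_zero, mul_zero]
    exact zero_le
  rw [abs_lt] at h
  have hy0 : 0 < y := by
    have : 0 < y / m := by linarith
    exact (div_pos_iff_of_pos_right hm).1 this
  have hy1 : y ≤ 2 * m := by
    rw [← div_le_iff₀ hm]; linarith
  rw [indicator_of_mem (mem_Ioi.2 hy0), ← mul_assoc, ← ENNReal.ofReal_mul (exp_nonneg _),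
    ← exp_add]
  gcongr
  nlinarith [mul_le_mul_of_nonneg_left hy1 (sub_nonneg.2 hθ)]

theorem le_aliveMass_exp_mul_bump (hB : IsPreBrownianReal B P) {a h : ℝ≥0} {τ : ℕ → ℝ≥0}
    {θ ℓ : ℕ → ℝ} (hτ : ∀ k, τ k = a + k * h) (hℓ0 : ℓ 0 = θ 0 * a)
    (hℓ : ∀ k, ℓ (k + 1) - ℓ k = θ (k + 1) * h) {n : ℕ} {m : ℝ} (hm : 0 < m)
    (hh : h ≤ m ^ 2 / 4) (hθ : ∀ k ≤ n, θ (k + 1) ≤ θ k) {j : ℕ} (hj : j ≤ n) :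
    ENNReal.ofReal (exp (-pathEnergy a h θ j / 2 - (θ 0 - θ (j + 1)) * (2 * m)) *
        (1 - 3 * (h / m ^ 2)) ^ j) *
        ∫⁻ z, ENNReal.ofReal (bump (z / m - 1)) ∂gaussianReal 0 a ≤
      aliveMass B P τ ℓ j (fun x => ENNReal.ofReal (exp (θ (j + 1) * x)) *
        ENNReal.ofReal (bump (x / m - 1))) := by
  have hmono : Monotone τ := by
    refine monotone_nat_of_le_succ fun k => ?_
    rw [hτ, hτ]; gcongr; simp
  have hr : 0 ≤ 1 - 3 * ((h : ℝ) / m ^ 2) := by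
    have : (h : ℝ) / m ^ 2 ≤ 1 / 4 := by rw [div_le_iff₀ (by positivity)]; linarith
    linarith
  have hmeas : ∀ c : ℝ, Measurable fun x : ℝ => ENNReal.ofReal (exp (c * x)) *
      ENNReal.ofReal (bump (x / m - 1)) := fun c => by fun_prop
  induction j with
  | zero =>
    rw [aliveMass_zero hB _ _ (hmeas _)]
    have h0 : τ 0 = a := by simp [hτ]
    have key := lintegral_exp_mul_gaussianReal a (θ 0) 0
      (G := fun y => ENNReal.ofReal (bump (y / m - 1))) (by fun_prop)
    simp only [zero_add] at key ⊢
    rw [h0, hℓ0]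
    calc _ = ENNReal.ofReal (exp (-(θ 0 - θ 1) * (2 * m))) *
          (ENNReal.ofReal (exp (θ 0 * 0 - θ 0 ^ 2 * a / 2)) *
          ∫⁻ z, ENNReal.ofReal (bump (z / m - 1)) ∂gaussianReal 0 a) := by
          rw [← mul_assoc (ENNReal.ofReal _) (ENNReal.ofReal _),
            ← ENNReal.ofReal_mul (exp_nonneg _), ← exp_add, pow_zero, mul_one]
          congr 3
          simp [pathEnergy]
          ring
      _ ≤ _ := by
          rw [← key, ← lintegral_const_mul' _ _ ENNReal.ofReal_ne_top]
          exact lintegral_mono fun z => exp_mul_bump_le_indicator hm (hθ 0 (by omega)) _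
  | succ j ih =>
    have hstep := le_aliveMass_succ (ℓ := ℓ) hB hmono (j := j) (hmeas (θ (j + 1 + 1)))
      (C := exp (-(θ (j + 1) ^ 2 * h) / 2 - (θ (j + 1) - θ (j + 1 + 1)) * (2 * m)) *
        (1 - 3 * (h / m ^ 2)))
      (φ := fun x => ENNReal.ofReal (exp (θ (j + 1) * x)) *
        ENNReal.ofReal (bump (x / m - 1))) ?_
    · refine le_trans ?_ hstep
      refine le_trans (le_of_eq ?_) (mul_le_mul_right (ih (by omega)) _)
      rw [← mul_assoc (ENNReal.ofReal _) (ENNReal.ofReal _),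
        ← ENNReal.ofReal_mul (mul_nonneg (exp_nonneg _) hr), pathEnergy_succ]
      congr 2
      rw [pow_succ, mul_mul_mul_comm, ← exp_add, mul_comm (1 - 3 * ((h : ℝ) / m ^ 2))]
      congr 2
      ring
    · intro x hx
      have hd : τ (j + 1) - τ j = h := by
        rw [hτ, hτ]; push_cast; rw [add_mul, one_mul, ← add_assoc]; exact add_tsub_cancel_left _ _
      rw [hd, hℓ]
      have key := lintegral_exp_mul_gaussianReal h (θ (j + 1)) x
        (G := fun y => ENNReal.ofReal (bump (y / m - 1))) (by fun_prop)
      calc _ = ENNReal.ofReal (exp (-(θ (j + 1) - θ (j + 1 + 1)) * (2 * m))) *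
            (ENNReal.ofReal (exp (θ (j + 1) * x - θ (j + 1) ^ 2 * h / 2)) *
            (ENNReal.ofReal (1 - 3 * (h / m ^ 2)) * ENNReal.ofReal (bump (x / m - 1)))) := by
            simp only [← mul_assoc]
            congr 1
            rw [← ENNReal.ofReal_mul (by positivity), ← ENNReal.ofReal_mul (by positivity),
              ← ENNReal.ofReal_mul (by positivity), mul_right_comm, ← exp_add, ← exp_add]
            congr 3
            ring
        _ ≤ ENNReal.ofReal (exp (-(θ (j + 1) - θ (j + 1 + 1)) * (2 * m))) *
            (ENNReal.ofReal (exp (θ (j + 1) * x - θ (j + 1) ^ 2 * h / 2)) *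
            ∫⁻ z, ENNReal.ofReal (bump ((x + z) / m - 1)) ∂gaussianReal 0 h) := by
            gcongr
            exact bump_lintegral_ge hm hh x
        _ ≤ _ := by
          rw [← key, ← lintegral_const_mul' _ _ ENNReal.ofReal_ne_top]
          exact lintegral_mono fun z => exp_mul_bump_le_indicator hm (hθ (j + 1) (by omega)) _

end WalkBounds

section BrownianMotion

variable {Ω : Type*} {mΩ : MeasurableSpace Ω} {P : Measure Ω}

theorem aemeasurable_of_map_eq_gaussianReal {f : Ω → ℝ} {v : ℝ≥0}
    (h : P.map f = gaussianReal 0 v) : AEMeasurable f P := by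
  by_contra hf
  rw [Measure.map_of_not_aemeasurable hf] at h
  have := congrArg (fun ν => ν univ) h
  simp at this

theorem isPreBrownianReal_of_gaussian {B : ℝ → Ω → ℝ}
    (hGauss : ∀ (n : ℕ) (t : Fin n → ℝ), (∀ i, 0 ≤ t i) → ∀ c : Fin n → ℝ,
      ∃ v : ℝ≥0, P.map (fun ω => ∑ i, c i * B (t i) ω) = gaussianReal 0 v)
    (hcovB : ∀ s t : ℝ, 0 ≤ s → 0 ≤ t → (∫ ω, B s ω * B t ω ∂P) = min s t) :
    IsPreBrownianReal (fun (t : ℝ≥0) => B t) P := by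
  have hone : ∀ t : ℝ≥0, ∃ v : ℝ≥0, P.map (B t) = gaussianReal 0 v := fun t => by
    obtain ⟨v, hv⟩ := hGauss 1 (fun _ => t) (fun _ => t.2) (fun _ => 1)
    exact ⟨v, by simpa using hv⟩
  have hae : ∀ t : ℝ≥0, AEMeasurable (B t) P := fun t =>
    aemeasurable_of_map_eq_gaussianReal (hone t).choose_spec
  have hmean : ∀ t : ℝ≥0, ∫ ω, B t ω ∂P = 0 := fun t => by
    obtain ⟨v, hv⟩ := hone t
    rw [show ∫ ω, B t ω ∂P = ∫ x, x ∂(P.map (B t)) from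
      (integral_map (hae t) aestronglyMeasurable_id).symm, hv, integral_id_gaussianReal]
  have hgp : IsGaussianProcess (fun (t : ℝ≥0) => B t) P := by
    refine ⟨fun I => ⟨?_⟩⟩
    have hmeas : AEMeasurable (fun ω => I.restrict fun t : ℝ≥0 => B t ω) P :=
      aemeasurable_pi_lambda _ fun i => hae i
    refine isGaussian_of_map_eq_gaussianReal fun L => ?_
    obtain ⟨v, hv⟩ := hGauss _ (fun i => ((I.equivFin.symm i : ℝ≥0) : ℝ)) (fun i => NNReal.coe_nonneg _)
      (fun i => L (fun j => if I.equivFin.symm i = j then 1 else 0))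
    refine ⟨0, v, ?_⟩
    rw [AEMeasurable.map_map_of_aemeasurable L.continuous.aemeasurable hmeas, ← hv]
    congr 1
    ext ω
    have := LinearMap.pi_apply_eq_sum_univ (L : (I → ℝ) →ₗ[ℝ] ℝ) (I.restrict fun t : ℝ≥0 => B t ω)
    simp only [Function.comp_apply]
    refine this.trans ?_
    rw [← Equiv.sum_comp I.equivFin.symm]
    refine Finset.sum_congr rfl fun i _ => ?_
    rw [smul_eq_mul, mul_comm]
    rfl
  have hlp : ∀ t : ℝ≥0, MemLp (B t) 2 P := fun t => (hgp.hasGaussianLaw_eval t).memLp_two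
  have := hgp.isProbabilityMeasure
  refine hgp.isPreBrownianReal_of_covariance hmean fun s t hst => ?_
  rw [covariance_eq_sub (hlp s) (hlp t)]
  simp only [hmean, mul_zero, sub_zero]
  exact (hcovB s t s.2 t.2).trans (min_eq_left (by exact_mod_cast hst))

end BrownianMotion

section Discretization

/-- The slopes of the piecewise linear interpolation of `f` at `0` (with value `0`) and at the
points `a, a + h, …, a + n * h`, extended by `0`. -/
noncomputable def gridSlope (f : ℝ → ℝ) (a h : ℝ) (n : ℕ) : ℕ → ℝ
  | 0 => f a / a
  | k + 1 => if k < n then (f (a + (k + 1) * h) - f (a + k * h)) / h else 0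

variable {f g : ℝ → ℝ} {a b c C h : ℝ} {n : ℕ}

theorem sum_gridSlope (hh : h ≠ 0) {j : ℕ} (hj : j ≤ n) :
    f a + ∑ k ∈ Finset.range j, gridSlope f a h n (k + 1) * h = f (a + j * h) := by
  induction j with
  | zero => simp
  | succ j ih =>
    rw [Finset.sum_range_succ, ← add_assoc, ih (by omega), gridSlope, if_pos (by omega),
      div_mul_cancel₀ _ hh]
    push_cast
    ring

theorem slope_mem_Icc (hf : ∀ t ∈ Icc a b, HasDerivAt f (g t) t)
    (hg : AntitoneOn g (Icc a b)) {p q : ℝ} (hp : a ≤ p) (hpq : p < q) (hq : q ≤ b) :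
    (f q - f p) / (q - p) ∈ Icc (g q) (g p) := by
  obtain ⟨ξ, hξ, h1⟩ := exists_hasDerivAt_eq_slope f g hpq
    (fun t ht => (hf t ⟨hp.trans ht.1, ht.2.trans hq⟩).continuousAt.continuousWithinAt)
    (fun t ht => hf t ⟨hp.trans ht.1.le, ht.2.le.trans hq⟩)
  rw [← h1]
  have hξ' : ξ ∈ Icc a b := ⟨hp.trans hξ.1.le, hξ.2.le.trans hq⟩
  exact ⟨hg hξ' ⟨hp.trans hpq.le, hq⟩ hξ.2.le, hg ⟨hp, hpq.le.trans hq⟩ hξ' hξ.1.le⟩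

theorem second_difference_ge (hf : ∀ t ∈ Icc a b, HasDerivAt f (g t) t)
    (hg : ∀ s t, a ≤ s → s ≤ t → t ≤ b → c * (t - s) ≤ g s - g t) {p : ℝ} (hh : 0 < h)
    (hp : a ≤ p) (hq : p + 2 * h ≤ b) :
    c * h ≤ (f (p + h) - f p) / h - (f (p + 2 * h) - f (p + h)) / h := by
  have hd : ∀ t ∈ Icc p (p + h), HasDerivAt (fun t => f (t + h) - f t) (g (t + h) - g t) t := by
    intro t ht
    refine HasDerivAt.sub ?_ (hf t ⟨hp.trans ht.1, by linarith [ht.2]⟩)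
    exact (hf (t + h) ⟨by linarith [ht.1], by linarith [ht.2]⟩).comp_add_const t h
  obtain ⟨ξ, hξ, h1⟩ := exists_hasDerivAt_eq_slope (fun t => f (t + h) - f t)
    (fun t => g (t + h) - g t) (show p < p + h by linarith)
    (fun t ht => (hd t ht).continuousAt.continuousWithinAt)
    (fun t ht => hd t ⟨ht.1.le, ht.2.le⟩)
  have h2 := hg ξ (ξ + h) (by linarith [hξ.1]) (by linarith) (by linarith [hξ.2])
  have h3 : (f (p + h) - f p) / h - (f (p + 2 * h) - f (p + h)) / h = - (g (ξ + h) - g ξ) := by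
    rw [h1, show p + h + h = p + 2 * h by ring]
    ring
  rw [h3]
  linarith [show c * (ξ + h - ξ) = c * h by ring]

theorem integral_sq_sub_slope_mem_Icc (hf : ∀ t ∈ Icc a b, HasDerivAt f (g t) t)
    (hg : AntitoneOn g (Icc a b)) (hgc : ContinuousOn g (Icc a b))
    (hgC : ∀ s t, a ≤ s → s ≤ t → t ≤ b → g s - g t ≤ C * (t - s)) {p q : ℝ} (hp : a ≤ p)
    (hpq : p < q) (hq : q ≤ b) :
    (∫ t in p..q, g t ^ 2) - ((f q - f p) / (q - p)) ^ 2 * (q - p) ∈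
      Icc 0 (C ^ 2 * (q - p) ^ 2 * (q - p)) := by
  set s := (f q - f p) / (q - p) with hs
  have hsub : uIcc p q ⊆ Icc a b := by
    rw [uIcc_of_le hpq.le]; exact Icc_subset_Icc hp hq
  have hgi : IntervalIntegrable g volume p q := (hgc.mono hsub).intervalIntegrable
  have hg2i : IntervalIntegrable (fun t => g t ^ 2) volume p q :=
    ((hgc.mono hsub).pow 2).intervalIntegrable
  have hint : ∫ t in p..q, g t = s * (q - p) := by
    rw [intervalIntegral.integral_eq_sub_of_hasDerivAt (fun t ht => hf t (hsub ht)) hgi, hs,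
      div_mul_cancel₀ _ (by linarith)]
  have key : (∫ t in p..q, g t ^ 2) - s ^ 2 * (q - p) = ∫ t in p..q, (g t - s) ^ 2 := by
    have h1 : ∀ t, (g t - s) ^ 2 = g t ^ 2 - 2 * s * g t + s ^ 2 := fun t => by ring
    simp_rw [h1]
    rw [intervalIntegral.integral_add (hg2i.sub (hgi.const_mul _)) (by simp),
      intervalIntegral.integral_sub hg2i (hgi.const_mul _), intervalIntegral.integral_const_mul,
      hint, intervalIntegral.integral_const, smul_eq_mul]
    ring
  rw [key]
  have hsm := slope_mem_Icc hf hg hp hpq hq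
  refine ⟨intervalIntegral.integral_nonneg hpq.le fun t _ => sq_nonneg _, ?_⟩
  have hb : ∀ t ∈ Icc p q, (g t - s) ^ 2 ≤ C ^ 2 * (q - p) ^ 2 := by
    intro t ht
    have h1 := hg ⟨hp, hpq.le.trans hq⟩ ⟨hp.trans ht.1, ht.2.trans hq⟩ ht.1
    have h2 := hg ⟨hp.trans ht.1, ht.2.trans hq⟩ ⟨hp.trans hpq.le, hq⟩ ht.2
    have h3 := hgC p q hp hpq.le hq
    rw [← mul_pow]
    refine sq_le_sq' ?_ ?_ <;> linarith [hsm.1, hsm.2]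
  calc _ ≤ ∫ t in p..q, C ^ 2 * (q - p) ^ 2 := by
        refine intervalIntegral.integral_mono_on hpq.le ?_ (by simp) hb
        exact (((hgc.mono hsub).sub continuousOn_const).pow 2).intervalIntegrable
    _ = _ := by rw [intervalIntegral.integral_const, smul_eq_mul]; ring

theorem gridSlope_energy_mem_Icc (hf : ∀ t ∈ Icc a b, HasDerivAt f (g t) t)
    (hg : AntitoneOn g (Icc a b)) (hgc : ContinuousOn g (Icc a b))
    (hgC : ∀ s t, a ≤ s → s ≤ t → t ≤ b → g s - g t ≤ C * (t - s)) (hh : 0 < h)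
    {j : ℕ} (hjn : j ≤ n) (hb : a + n * h ≤ b) :
    (∫ t in a..(a + j * h), g t ^ 2) - ∑ k ∈ Finset.range j, gridSlope f a h n (k + 1) ^ 2 * h ∈
      Icc 0 (C ^ 2 * h ^ 2 * (j * h)) := by
  have hle : ∀ i ≤ n, a + i * h ≤ b := fun i hi => by
    have : (i : ℝ) ≤ n := by exact_mod_cast hi
    nlinarith
  induction j with
  | zero => simp
  | succ j ih =>
    have ih := ih (by omega)
    have ha : ∀ i : ℕ, a ≤ a + i * h := fun i => by
      have : 0 ≤ (i : ℝ) * h := by positivity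
      linarith
    have hs := integral_sq_sub_slope_mem_Icc hf hg hgc hgC (p := a + j * h)
      (q := a + (j + 1 : ℕ) * h) (ha j) (by push_cast; linarith) (hle _ hjn)
    have hi : ∀ i ≤ n, ∀ i' ≤ n,
        IntervalIntegrable (fun t => g t ^ 2) volume (a + i * h) (a + i' * h) := by
      intro i hi i' hi'
      refine ((hgc.mono ?_).pow 2).intervalIntegrable
      exact uIcc_subset_Icc ⟨ha i, hle i hi⟩ ⟨ha i', hle i' hi'⟩
    have h0 := hi 0 (by omega) j (by omega)
    simp only [Nat.cast_zero, zero_mul, add_zero] at h0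
    rw [show a + ((j + 1 : ℕ) : ℝ) * h - (a + j * h) = h by push_cast; ring] at hs
    rw [Finset.sum_range_succ, ← intervalIntegral.integral_add_adjacent_intervals h0
      (hi j (by omega) (j + 1) hjn), gridSlope, if_pos (by omega)]
    push_cast at hs ⊢
    constructor <;> linarith [hs.1, hs.2, ih.1, ih.2]

theorem gridSlope_one_le (hf : ∀ t ∈ Icc a b, HasDerivAt f (g t) t)
    (hg : AntitoneOn g (Icc a b)) (hA : g a ≤ f a / a) (hh : 0 < h) (hn : 1 ≤ n)
    (hb : a + n * h ≤ b) : gridSlope f a h n 1 ≤ gridSlope f a h n 0 := by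
  have : a + 1 * h ≤ b := by
    have : (1 : ℝ) ≤ n := by exact_mod_cast hn
    nlinarith
  have h2 := (slope_mem_Icc hf hg le_rfl (show a < a + 1 * h by linarith) this).2
  rw [show a + 1 * h - a = h by ring] at h2
  have h3 : gridSlope f a h n 1 = (f (a + 1 * h) - f a) / h := by
    rw [gridSlope, if_pos (by omega)]; simp
  rw [h3]
  exact h2.trans hA

theorem le_gridSlope_sub (hf : ∀ t ∈ Icc a b, HasDerivAt f (g t) t)
    (hanti : AntitoneOn g (Icc a b))
    (hg : ∀ s t, a ≤ s → s ≤ t → t ≤ b → c * (t - s) ≤ g s - g t) (hh : 0 < h)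
    (hb : a + n * h ≤ b) (hgb : c * h ≤ g b) {k : ℕ} (hk : k < n) :
    c * h ≤ gridSlope f a h n (k + 1) - gridSlope f a h n (k + 2) := by
  have hle : ∀ i ≤ n, a + i * h ≤ b := fun i hi => by
    have : (i : ℝ) ≤ n := by exact_mod_cast hi
    nlinarith
  have ha : ∀ i : ℕ, a ≤ a + i * h := fun i => by
    have : 0 ≤ (i : ℝ) * h := by positivity
    linarith
  rw [gridSlope, gridSlope, if_pos hk]
  split_ifs with hk'
  · have := second_difference_ge hf hg hh (ha k) (by
      have := hle (k + 2) (by omega); push_cast at this; linarith)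
    convert this using 5 <;> push_cast <;> ring
  · have hkb := hle (k + 1) hk
    have := (slope_mem_Icc hf hanti (ha k)
      (show a + k * h < a + (k + 1 : ℕ) * h by push_cast; linarith) hkb).1
    rw [show a + ((k + 1 : ℕ) : ℝ) * h - (a + k * h) = h by push_cast; ring] at this
    have h2 := hanti ⟨ha (k + 1), hkb⟩ ⟨(ha (k + 1)).trans hkb, le_rfl⟩ hkb
    push_cast at this h2 ⊢
    linarith

end Discretization

section GridBounds

/-- `f` is a uniformly concave increasing function on `[a, b]` with derivative `g`, whose
linear extension to `0` is still concave. -/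
structure IsConcaveBarrier (f g : ℝ → ℝ) (a b c C : ℝ) : Prop where
  pos : 0 < a
  lt : a < b
  c_pos : 0 < c
  hasDerivAt : ∀ t ∈ Icc a b, HasDerivAt f (g t) t
  le_sub : ∀ s t, a ≤ s → s ≤ t → t ≤ b → c * (t - s) ≤ g s - g t
  sub_le : ∀ s t, a ≤ s → s ≤ t → t ≤ b → g s - g t ≤ C * (t - s)
  slope_le : g a ≤ f a / a
  slope_pos : 0 < g b

/-- The energy of a barrier. -/
noncomputable def barrierEnergy (f g : ℝ → ℝ) (a b : ℝ) : ℝ :=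
  f a ^ 2 / a + ∫ t in a..b, g t ^ 2

variable {f g : ℝ → ℝ} {b c C : ℝ} {Ω : Type*} {mΩ : MeasurableSpace Ω} {P : Measure Ω}
  {B : ℝ≥0 → Ω → ℝ}

theorem IsConcaveBarrier.antitoneOn {a : ℝ} (H : IsConcaveBarrier f g a b c C) :
    AntitoneOn g (Icc a b) := by
  intro s hs t ht hst
  have := H.le_sub s t hs.1 hst ht.2
  have h2 : 0 ≤ c * (t - s) := mul_nonneg H.c_pos.le (by linarith)
  linarith

theorem IsConcaveBarrier.continuousOn {a : ℝ} (H : IsConcaveBarrier f g a b c C) :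
    ContinuousOn g (Icc a b) := by
  have hC : ∀ s ∈ Icc a b, ∀ t ∈ Icc a b, |g s - g t| ≤ |C| * |s - t| := by
    have key : ∀ s ∈ Icc a b, ∀ t ∈ Icc a b, s ≤ t → |g s - g t| ≤ |C| * |s - t| := by
      intro s hs t ht hst
      rw [abs_of_nonneg (sub_nonneg.2 (H.antitoneOn hs ht hst)), abs_sub_comm s t,
        abs_of_nonneg (sub_nonneg.2 hst)]
      exact (H.sub_le s t hs.1 hst ht.2).trans
        (mul_le_mul_of_nonneg_right (le_abs_self C) (sub_nonneg.2 hst))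
    intro s hs t ht
    rcases le_total s t with h | h
    · exact key s hs t ht h
    · rw [abs_sub_comm (g s), abs_sub_comm s]; exact key t ht s hs h
  refine LipschitzOnWith.continuousOn (K := ⟨|C|, abs_nonneg C⟩) ?_
  refine LipschitzOnWith.of_dist_le_mul fun s hs t ht => ?_
  rw [Real.dist_eq, Real.dist_eq]
  exact hC s hs t ht

variable {a h : ℝ≥0} {n : ℕ} {u : ℝ}

theorem barrier_level_eq (ha : 0 < a) (hh : 0 < h) {j : ℕ} (hj : j ≤ n) :
    u * gridSlope f a h n 0 * a + ∑ k ∈ Finset.range j, u * gridSlope f a h n (k + 1) * h =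
      u * f (a + j * h) := by
  have hne : (h : ℝ) ≠ 0 := by exact_mod_cast hh.ne'
  have hane : (a : ℝ) ≠ 0 := by exact_mod_cast ha.ne'
  rw [← sum_gridSlope (f := f) (a := a) hne hj, mul_add, Finset.mul_sum]
  congr 1
  · rw [gridSlope]; field_simp
  · exact Finset.sum_congr rfl fun _ _ => by ring

theorem grid_event_eq (hB : IsPreBrownianReal B P) (ha : 0 < a) (hh : 0 < h) :
    aliveMass B P (fun k => a + k * h) (fun j => u * gridSlope f a h n 0 * a +
      ∑ k ∈ Finset.range j, u * gridSlope f a h n (k + 1) * h) n 1 =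
    P {ω | ∀ i ≤ n, u * f (a + i * h) < B (a + i * h) ω} := by
  rw [aliveMass_one_eq hB]
  congr 1
  ext ω
  simp only [mem_ofPred_eq]
  refine forall₂_congr fun i hi => ?_
  rw [barrier_level_eq ha hh hi]

theorem pathEnergy_gridSlope (ha : 0 < a) :
    pathEnergy a h (fun k => u * gridSlope f a h n k) n =
      u ^ 2 * (f a ^ 2 / a + ∑ k ∈ Finset.range n, gridSlope f a h n (k + 1) ^ 2 * h) := by
  have hane : (a : ℝ) ≠ 0 := by exact_mod_cast ha.ne'
  rw [pathEnergy, mul_add, Finset.mul_sum]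
  congr 1
  · rw [gridSlope]; field_simp
  · exact Finset.sum_congr rfl fun _ _ => by ring

theorem grid_measure_le (hB : IsPreBrownianReal B P) (H : IsConcaveBarrier f g a b c C)
    (hh : 0 < h) (hn : 1 ≤ n) (hb : a + n * h = b) (hgb : c * h ≤ g b) (hu : 0 < u) :
    P {ω | ∀ i ≤ n, u * f (a + i * h) < B (a + i * h) ω} ≤
      ENNReal.ofReal (exp (-(u ^ 2 * (barrierEnergy f g a b - C ^ 2 * h ^ 2 * (b - a))) / 2) *
        (1 - (gaussianReal 0 1).real (Ici 1) * (1 - exp (-(u * (c * h) * √h)))) ^ n) := by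
  have ha : 0 < a := by exact_mod_cast H.pos
  have hhr : (0 : ℝ) < h := by exact_mod_cast hh
  have hlast : gridSlope f a h n (n + 1) = 0 := by simp [gridSlope]
  have key := aliveMass_exp_le (B := B) (P := P) (τ := fun k => a + k * h)
    (θ := fun k => u * gridSlope f a h n k)
    (ℓ := fun j => u * gridSlope f a h n 0 * a +
      ∑ k ∈ Finset.range j, u * gridSlope f a h n (k + 1) * h) hB (a := a) (h := h)
    (fun k => rfl) (by simp) (fun k => by simp [Finset.sum_range_succ]) (n := n)
    (κ := u * (c * h)) (mul_nonneg hu.le (mul_nonneg H.c_pos.le h.2))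
    (mul_le_mul_of_nonneg_left
      (gridSlope_one_le H.hasDerivAt H.antitoneOn H.slope_le hhr hn hb.le) hu.le)
    (fun k hk => by
      simp only [← mul_sub]
      exact mul_le_mul_of_nonneg_left
        (le_gridSlope_sub H.hasDerivAt H.antitoneOn H.le_sub hhr hb.le hgb hk) hu.le)
    le_rfl
  simp only [hlast, mul_zero, zero_mul, exp_zero, ENNReal.ofReal_one] at key
  rw [pathEnergy_gridSlope ha] at key
  rw [← grid_event_eq hB ha hh]
  refine le_trans key (ENNReal.ofReal_le_ofReal ?_)
  have hq : 0 ≤ 1 - (gaussianReal 0 1).real (Ici 1) * (1 - exp (-(u * (c * h) * √h))) := by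
    have h1 : (gaussianReal 0 1).real (Ici 1) ≤ 1 := measureReal_le_one
    have h2 := exp_pos (-(u * (c * h) * √h))
    have h3 : 0 ≤ (gaussianReal 0 1).real (Ici 1) := measureReal_nonneg
    have h4 := exp_le_one_iff.2 (show -(u * (c * h) * √h) ≤ 0 by
      have := H.c_pos; rw [neg_nonpos]; positivity)
    nlinarith
  refine mul_le_mul_of_nonneg_right (exp_le_exp.2 ?_) (pow_nonneg hq _)
  have he := (gridSlope_energy_mem_Icc H.hasDerivAt H.antitoneOn H.continuousOn H.sub_le hhr
    le_rfl hb.le).2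
  rw [hb, show (n : ℝ) * h = b - a by linarith] at he
  rw [barrierEnergy]
  have := mul_le_mul_of_nonneg_left he (sq_nonneg u)
  linarith

theorem le_grid_measure (hB : IsPreBrownianReal B P) (H : IsConcaveBarrier f g a b c C)
    (hh : 0 < h) (hn : 1 ≤ n) (hb : a + n * h = b) (hgb : c * h ≤ g b) (hu : 0 < u) {m : ℝ}
    (hm : 0 < m) (hhm : h ≤ m ^ 2 / 4) :
    ENNReal.ofReal (exp (-(u ^ 2 * barrierEnergy f g a b) / 2 - u * (f a / a) * (2 * m)) *
        (1 - 3 * (h / m ^ 2)) ^ n) *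
        ∫⁻ z, ENNReal.ofReal (bump (z / m - 1)) ∂gaussianReal 0 a ≤
      P {ω | ∀ i ≤ n, u * f (a + i * h) < B (a + i * h) ω} := by
  have ha : 0 < a := by exact_mod_cast H.pos
  have hhr : (0 : ℝ) < h := by exact_mod_cast hh
  have hlast : gridSlope f a h n (n + 1) = 0 := by simp [gridSlope]
  have hanti : ∀ k ≤ n, gridSlope f a h n (k + 1) ≤ gridSlope f a h n k := by
    rintro (_ | k) hk
    · exact gridSlope_one_le H.hasDerivAt H.antitoneOn H.slope_le hhr hn hb.le
    · have := le_gridSlope_sub H.hasDerivAt H.antitoneOn H.le_sub hhr hb.le hgb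
        (k := k) (by omega)
      have h2 := mul_pos H.c_pos hhr
      show gridSlope f a h n (k + 2) ≤ _
      linarith
  have key := le_aliveMass_exp_mul_bump (B := B) (P := P) (τ := fun k => a + k * h)
    (θ := fun k => u * gridSlope f a h n k)
    (ℓ := fun j => u * gridSlope f a h n 0 * a +
      ∑ k ∈ Finset.range j, u * gridSlope f a h n (k + 1) * h) hB (a := a) (h := h)
    (fun k => rfl) (by simp) (fun k => by simp [Finset.sum_range_succ]) (n := n) hm hhm
    (fun k hk => mul_le_mul_of_nonneg_left (hanti k hk) hu.le) le_rfl
  simp only [hlast, mul_zero, zero_mul, exp_zero, ENNReal.ofReal_one, one_mul, sub_zero] at key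
  rw [pathEnergy_gridSlope ha] at key
  rw [← grid_event_eq hB ha hh]
  have hr : 0 ≤ 1 - 3 * ((h : ℝ) / m ^ 2) := by
    have : (h : ℝ) / m ^ 2 ≤ 1 / 4 := by rw [div_le_iff₀ (by positivity)]; linarith
    linarith
  refine le_trans ?_ (key.trans (lintegral_mono fun ω => indicator_le_indicator ?_))
  · have he := (gridSlope_energy_mem_Icc H.hasDerivAt H.antitoneOn H.continuousOn H.sub_le hhr
      le_rfl hb.le).1
    rw [hb] at he
    gcongr
    · rw [barrierEnergy]
      linarith
    · exact le_rfl
  · simp only [Pi.one_apply, ENNReal.ofReal_le_one]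
    exact bump_le_one _

end GridBounds

section UpperBound

variable {f g : ℝ → ℝ} {b c C : ℝ} {Ω : Type*} {mΩ : MeasurableSpace Ω} {P : Measure Ω}
  {B : ℝ≥0 → Ω → ℝ} {a : ℝ≥0}

theorem gaussianReal_real_Ici_pos : 0 < (gaussianReal 0 1).real (Ici 1) := by
  rw [measureReal_def, ENNReal.toReal_pos_iff]
  refine ⟨?_, measure_lt_top _ _⟩
  rw [pos_iff_ne_zero]
  intro h
  have h1 := gaussianReal_absolutelyContinuous' 0 one_ne_zero h
  simp at h1

theorem one_sub_mul_pow_le {p η : ℝ} (hp : 0 ≤ p) (hp1 : p ≤ 1) (hη : 0 ≤ η) (hη1 : η ≤ 1)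
    (n : ℕ) : (1 - p * (1 - exp (-η))) ^ n ≤ exp (-(p * (n * η) / 2)) := by
  have h1 : exp (-η) ≤ 1 - η / 2 := by
    have h2 : (1 + η) * exp (-η) ≤ 1 := by
      rw [exp_neg, ← div_eq_mul_inv, div_le_one (exp_pos _)]
      linarith [add_one_le_exp η]
    nlinarith [exp_pos (-η)]
  have h0 : 0 ≤ 1 - p * (1 - exp (-η)) := by nlinarith [exp_pos (-η)]
  have h3 : 1 - p * (1 - exp (-η)) ≤ exp (-(p * η / 2)) := by
    refine le_trans ?_ (one_sub_le_exp_neg _)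
    nlinarith
  refine (pow_le_pow_left₀ h0 h3 n).trans_eq ?_
  rw [← exp_nat_mul]
  congr 1
  ring

theorem exists_barrier_measure_le (hB : IsPreBrownianReal B P)
    (H : IsConcaveBarrier f g a b c C) :
    ∃ κ > 0, ∀ᶠ w : ℝ in atTop,
      P {ω | ∀ t : ℝ≥0, (t : ℝ) ∈ Icc (a : ℝ) b → w ^ 3 * f t < B t ω} ≤
        ENNReal.ofReal (exp (-((w ^ 3) ^ 2 * barrierEnergy f g a b) / 2 - κ * w ^ 2)) := by
  set p := (gaussianReal 0 1).real (Ici 1) with hp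
  have hp0 : 0 < p := gaussianReal_real_Ici_pos
  have hp1 : p ≤ 1 := measureReal_le_one
  obtain ⟨L, hL⟩ : ∃ L : ℝ, L = b - a := ⟨_, rfl⟩
  have hL0 : 0 < L := by linarith [H.lt]
  have hc := H.c_pos
  set A := p * c * L * √(L / 2) with hA
  have hA0 : 0 < A := by positivity
  obtain ⟨d, hd0, hd1, hd2⟩ : ∃ d > 0, C ^ 2 * L ^ 3 * d ^ 3 ≤ A / 2 ∧ c * L * √L * d ^ 3 ≤ 1 := by
    have h1 : Tendsto (fun d : ℝ => C ^ 2 * L ^ 3 * d ^ 3) (nhdsWithin 0 (Ioi 0)) (nhds 0) := by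
      have : Continuous fun d : ℝ => C ^ 2 * L ^ 3 * d ^ 3 := by fun_prop
      simpa using (this.tendsto 0).mono_left nhdsWithin_le_nhds
    have h2 : Tendsto (fun d : ℝ => c * L * √L * d ^ 3) (nhdsWithin 0 (Ioi 0)) (nhds 0) := by
      have : Continuous fun d : ℝ => c * L * √L * d ^ 3 := by fun_prop
      simpa using (this.tendsto 0).mono_left nhdsWithin_le_nhds
    obtain ⟨d, hd⟩ := ((h1.eventually_le_const (half_pos hA0)).and
      ((h2.eventually_le_const one_pos).and self_mem_nhdsWithin)).exists
    exact ⟨d, hd.2.2, hd.1, hd.2.1⟩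
  refine ⟨d * A / 4, by positivity, ?_⟩
  have hev : ∀ᶠ w : ℝ in atTop, c * (L * d ^ 2) / g b ≤ w ^ 2 :=
    (tendsto_pow_atTop two_ne_zero).eventually_ge_atTop _
  filter_upwards [hev, eventually_ge_atTop 1, eventually_ge_atTop d] with w hw1 hw2 hw3
  have hw0 : 0 < w := by linarith
  obtain ⟨n, hn⟩ : ∃ n : ℕ, n = ⌈w ^ 2 / d ^ 2⌉₊ := ⟨_, rfl⟩
  have hr1 : 1 ≤ w ^ 2 / d ^ 2 := by
    rw [one_le_div (by positivity)]; gcongr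
  have hn1 : w ^ 2 / d ^ 2 ≤ n := hn ▸ Nat.le_ceil _
  have hn2 : (n : ℝ) ≤ 2 * (w ^ 2 / d ^ 2) := by
    have := Nat.ceil_lt_add_one (show 0 ≤ w ^ 2 / d ^ 2 by positivity)
    rw [← hn] at this; linarith
  have hn0 : (1 : ℝ) ≤ n := hr1.trans hn1
  have hn0' : 1 ≤ n := by exact_mod_cast hn0
  have hnpos : (0 : ℝ) < n := by linarith
  obtain ⟨h, hh⟩ : ∃ h : ℝ≥0, (h : ℝ) = L / n := ⟨⟨L / n, by positivity⟩, rfl⟩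
  have hhr : (0 : ℝ) < h := by rw [hh]; positivity
  have hnh : (n : ℝ) * h = L := by rw [hh]; field_simp
  have hh1 : (h : ℝ) ≤ L * d ^ 2 / w ^ 2 := by
    rw [hh, div_le_div_iff₀ hnpos (by positivity)]
    rw [div_le_iff₀ (by positivity)] at hn1
    nlinarith
  have hh2 : L / 2 * (d / w) ^ 2 ≤ h := by
    rw [hh, le_div_iff₀ hnpos]
    have : (d / w) ^ 2 * (w ^ 2 / d ^ 2) = 1 := by field_simp
    calc L / 2 * (d / w) ^ 2 * n ≤ L / 2 * (d / w) ^ 2 * (2 * (w ^ 2 / d ^ 2)) := by gcongr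
      _ = L * ((d / w) ^ 2 * (w ^ 2 / d ^ 2)) := by ring
      _ = L := by rw [this, mul_one]
  have hs1 : √h ≤ √L * (d / w) := by
    rw [← sqrt_sq (show 0 ≤ d / w by positivity), ← sqrt_mul hL0.le]
    refine sqrt_le_sqrt (hh1.trans_eq ?_)
    rw [div_pow, mul_div_assoc]
  have hs2 : √(L / 2) * (d / w) ≤ √h := by
    rw [← sqrt_sq (show 0 ≤ d / w by positivity), ← sqrt_mul (by positivity)]
    exact sqrt_le_sqrt hh2
  have hη1 : w ^ 3 * (c * h) * √h ≤ 1 := by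
    calc w ^ 3 * (c * h) * √h ≤ w ^ 3 * (c * (L * d ^ 2 / w ^ 2)) * (√L * (d / w)) := by gcongr
      _ = c * L * √L * d ^ 3 := by field_simp
      _ ≤ 1 := hd2
  have hgb : c * h ≤ g b := by
    rw [div_le_iff₀ H.slope_pos] at hw1
    calc c * h ≤ c * (L * d ^ 2 / w ^ 2) := by gcongr
      _ = c * (L * d ^ 2) / w ^ 2 := by ring
      _ ≤ g b := by rw [div_le_iff₀ (by positivity)]; linarith
  have hb : (a : ℝ) + n * h = b := by rw [hnh, hL]; ring
  have hgrid := grid_measure_le hB H (by exact_mod_cast hhr) hn0' hb hgb (u := w ^ 3)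
    (by positivity)
  have hsub : {ω | ∀ t : ℝ≥0, (t : ℝ) ∈ Icc (a : ℝ) b → w ^ 3 * f t < B t ω} ⊆
      {ω | ∀ i ≤ n, w ^ 3 * f (a + i * h) < B (a + i * h) ω} := by
    intro ω hω i hi
    have := hω (a + i * h) ?_
    · push_cast at this; exact this
    · have : (i : ℝ) ≤ n := by exact_mod_cast hi
      push_cast
      constructor
      · have : (0 : ℝ) ≤ i * h := by positivity
        linarith
      · rw [← hb]; gcongr
  refine (measure_mono hsub).trans (hgrid.trans (ENNReal.ofReal_le_ofReal ?_))
  · have hq := one_sub_mul_pow_le hp0.le hp1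
      (show 0 ≤ w ^ 3 * (c * h) * √h by positivity) hη1 n
    refine (mul_le_mul_of_nonneg_left hq (exp_nonneg _)).trans ?_
    rw [← exp_add]
    refine exp_le_exp.2 ?_
    have e1 : A * d * w ^ 2 ≤ p * (n * (w ^ 3 * (c * h) * √h)) := by
      calc A * d * w ^ 2 = p * (w ^ 3 * c * L * (√(L / 2) * (d / w))) := by
            rw [hA]; field_simp
        _ ≤ p * (w ^ 3 * c * L * √h) := by gcongr
        _ = _ := by rw [← hnh]; ring
    have e2 : (w ^ 3) ^ 2 * (C ^ 2 * h ^ 2 * L) ≤ d * A / 2 * w ^ 2 := by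
      calc (w ^ 3) ^ 2 * (C ^ 2 * h ^ 2 * L) ≤
          (w ^ 3) ^ 2 * (C ^ 2 * (L * d ^ 2 / w ^ 2) ^ 2 * L) := by gcongr
        _ = (C ^ 2 * L ^ 3 * d ^ 3) * (d * w ^ 2) := by field_simp
        _ ≤ A / 2 * (d * w ^ 2) := by gcongr
        _ = _ := by ring
    rw [← hL]
    linarith

end UpperBound

section LowerBound

variable {f g : ℝ → ℝ} {b c C : ℝ} {Ω : Type*} {mΩ : MeasurableSpace Ω} {P : Measure Ω}
  {B : ℝ≥0 → Ω → ℝ} {a : ℝ≥0}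

theorem exists_le_lintegral_bump {v : ℝ≥0} (hv : v ≠ 0) :
    ∃ c₁ > 0, ∀ m : ℝ, 0 < m → m ≤ 1 / 2 →
      ENNReal.ofReal (c₁ * m) ≤ ∫⁻ z, ENNReal.ofReal (bump (z / m - 1)) ∂gaussianReal 0 v := by
  have hβ : 0 < exp (-(1 / 2)) - exp (-2) := sub_pos.2 (exp_lt_exp.2 (by norm_num))
  have hγ : 0 < gaussianPDFReal 0 v 1 := gaussianPDFReal_pos _ _ _ hv
  refine ⟨(exp (-(1 / 2)) - exp (-2)) * gaussianPDFReal 0 v 1, by positivity, fun m hm hm2 => ?_⟩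
  calc ENNReal.ofReal ((exp (-(1 / 2)) - exp (-2)) * gaussianPDFReal 0 v 1 * m)
      = ∫⁻ z in Icc (m / 2) (3 * m / 2),
          ENNReal.ofReal ((exp (-(1 / 2)) - exp (-2)) * gaussianPDFReal 0 v 1) := by
        rw [setLIntegral_const, Real.volume_Icc, ← ENNReal.ofReal_mul (by positivity)]
        congr 2
        ring
    _ ≤ ∫⁻ z in Icc (m / 2) (3 * m / 2),
          ENNReal.ofReal (gaussianPDFReal 0 v z) * ENNReal.ofReal (bump (z / m - 1)) := by
        refine setLIntegral_mono' measurableSet_Icc fun z hz => ?_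
        rw [← ENNReal.ofReal_mul (gaussianPDFReal_nonneg _ _ _)]
        refine ENNReal.ofReal_le_ofReal ?_
        rw [mul_comm]
        have hz1 : |z / m - 1| ≤ 1 / 2 := by
          rw [abs_le]
          constructor
          · have := (le_div_iff₀ hm).2 (show 1 / 2 * m ≤ z by linarith [hz.1])
            linarith
          · have := (div_le_iff₀ hm).2 (show z ≤ 3 / 2 * m by linarith [hz.2])
            linarith
        refine mul_le_mul ?_ ?_ hβ.le (gaussianPDFReal_nonneg _ _ _)
        · rw [gaussianPDFReal, gaussianPDFReal]
          have h0 : 0 ≤ z := by linarith [hz.1]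
          have h1 : z ≤ 1 := by linarith [hz.2]
          gcongr
        · rw [bump]
          have : (z / m - 1) ^ 2 ≤ (1 / 2) ^ 2 := sq_le_sq' (abs_le.1 hz1).1 (abs_le.1 hz1).2
          refine sub_le_sub_right (exp_le_exp.2 ?_) _
          linarith
    _ ≤ ∫⁻ z, ENNReal.ofReal (gaussianPDFReal 0 v z) * ENNReal.ofReal (bump (z / m - 1)) :=
        setLIntegral_le_lintegral _ _
    _ = ∫⁻ z, ENNReal.ofReal (bump (z / m - 1)) ∂gaussianReal 0 v := by
        rw [gaussianReal_of_var_ne_zero _ hv, lintegral_withDensity_eq_lintegral_mul _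
          (measurable_gaussianPDF _ _) (by fun_prop)]
        rfl

theorem exp_neg_le_one_sub_pow {x : ℝ} (hx : 0 ≤ x) (hx1 : x ≤ 1 / 2) (n : ℕ) :
    exp (-(2 * (n * x))) ≤ (1 - x) ^ n := by
  have h1 : exp (-(2 * x)) ≤ 1 - x := by
    have h2 : (1 + 2 * x) * exp (-(2 * x)) ≤ 1 := by
      rw [exp_neg, ← div_eq_mul_inv, div_le_one (exp_pos _)]
      linarith [add_one_le_exp (2 * x)]
    nlinarith [exp_pos (-(2 * x))]
  refine le_trans (le_of_eq ?_) (pow_le_pow_left₀ (exp_nonneg _) h1 n)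
  rw [← exp_nat_mul]
  congr 1
  ring

theorem IsConcaveBarrier.pos_of_mem (H : IsConcaveBarrier f g a b c C) {t : ℝ}
    (ht : t ∈ Icc (a : ℝ) b) : 0 < f t := by
  have ha := H.pos
  have hga : g b ≤ g a := H.antitoneOn ⟨le_rfl, H.lt.le⟩ ⟨H.lt.le, le_rfl⟩ H.lt.le
  have hfa : 0 < f a := by
    have := H.slope_pos.trans_le (hga.trans H.slope_le)
    exact (div_pos_iff_of_pos_right ha).1 this
  rcases eq_or_lt_of_le ht.1 with h | h
  · rwa [← h]
  have h1 := (slope_mem_Icc H.hasDerivAt H.antitoneOn le_rfl h ht.2).1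
  have h2 : g b ≤ g t := H.antitoneOn ht ⟨H.lt.le, le_rfl⟩ ht.2
  have h3 := (H.slope_pos.trans_le (h2.trans h1))
  have := (div_pos_iff_of_pos_right (sub_pos.2 h)).1 h3
  linarith

/-- Passing from dyadic grids to the whole interval. -/
theorem le_measure_of_forall_grid [IsFiniteMeasure P] (hae : ∀ t, AEMeasurable (B t) P)
    (hcont : ∀ ω, Continuous fun t => B t ω) {φ : ℝ → ℝ}
    (hφ : ContinuousOn φ (Icc (a : ℝ) b)) (hab : a < b) {h : ℕ → ℝ≥0}
    (hh : ∀ N, (2 : ℝ) ^ N * h N = b - a) {r : ℝ≥0∞} {N₀ : ℕ}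
    (hr : ∀ N ≥ N₀, r ≤ P {ω | ∀ i : ℕ, i ≤ 2 ^ N → φ (a + i * h N) < B (a + i * h N) ω}) :
    r ≤ P {ω | ∀ t : ℝ≥0, (t : ℝ) ∈ Icc (a : ℝ) b → φ t ≤ B t ω} := by
  set E : ℕ → Set Ω := fun N => {ω | ∀ i : ℕ, i ≤ 2 ^ N → φ (a + i * h N) < B (a + i * h N) ω} with hE
  have hhh : ∀ N, h N = 2 * h (N + 1) := fun N => by
    have h1 := hh N
    have h2 := hh (N + 1)
    rw [pow_succ, ← h1] at h2
    have h3 : (0 : ℝ) < 2 ^ N := by positivity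
    rw [← NNReal.coe_inj]
    push_cast
    have : (2 : ℝ) ^ N * (2 * h (N + 1)) = 2 ^ N * h N := by linarith
    exact (mul_left_cancel₀ h3.ne' this).symm
  have hanti : Antitone E := antitone_nat_of_succ_le fun N ω hω i hi => by
    have := hω (2 * i) (by rw [pow_succ]; omega)
    rw [hhh N]
    have e : ((2 * i : ℕ) : ℝ≥0) * h (N + 1) = i * (2 * h (N + 1)) := by push_cast; ring
    have e' : ((2 * i : ℕ) : ℝ) * h (N + 1) = i * (2 * h (N + 1) : ℝ≥0) := by push_cast; ring
    rwa [e, e'] at this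
  have hnull : ∀ N, NullMeasurableSet (E N) P := fun N => by
    have : E N = ⋂ i : ℕ, ⋂ (_ : i ≤ 2 ^ N), {ω | φ (a + i * h N) < B (a + i * h N) ω} := by
      ext ω; simp [hE]
    rw [this]
    exact .iInter fun i => .iInter fun _ => nullMeasurableSet_lt aemeasurable_const (hae _)
  have hlim := tendsto_measure_iInter_atTop hnull hanti ⟨0, measure_ne_top _ _⟩
  refine (ge_of_tendsto hlim (eventually_atTop.2 ⟨N₀, hr⟩)).trans (measure_mono ?_)
  intro ω hω t ht
  rw [mem_iInter] at hω
  have hpos : ∀ N, (0 : ℝ) < h N := fun N => by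
    have h1 := hh N
    have h3 : (0 : ℝ) < 2 ^ N := by positivity
    exact (mul_pos_iff_of_pos_left h3).1 (h1 ▸ sub_pos.2 hab)
  have hh0 : Tendsto (fun N => (h N : ℝ)) atTop (nhds 0) := by
    have h1 : ∀ N, (h N : ℝ) = (b - a) * (1 / 2) ^ N := fun N => by
      rw [← hh N, one_div, inv_pow]; field_simp
    simp_rw [h1]
    simpa using (tendsto_pow_atTop_nhds_zero_of_lt_one (by norm_num : (0 : ℝ) ≤ 1 / 2)
      (by norm_num)).const_mul (b - a : ℝ)
  set i : ℕ → ℕ := fun N => ⌊((t : ℝ) - a) / h N⌋₊ with hi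
  have hi1 : ∀ N, (i N : ℝ) * h N ≤ t - a := fun N => by
    rw [← le_div_iff₀ (hpos N)]
    exact Nat.floor_le (div_nonneg (sub_nonneg.2 ht.1) (hpos N).le)
  have hi2 : ∀ N, (t : ℝ) - a ≤ i N * h N + h N := fun N => by
    have := (Nat.lt_floor_add_one (((t : ℝ) - a) / h N)).le
    rw [div_le_iff₀ (hpos N)] at this
    linarith
  have hi3 : ∀ N, i N ≤ 2 ^ N := fun N => by
    refine Nat.floor_le_of_le ?_
    rw [div_le_iff₀ (hpos N)]
    push_cast
    rw [hh N]
    linarith [ht.2]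
  have htR : Tendsto (fun N => (a : ℝ) + i N * h N) atTop (nhds t) := by
    refine tendsto_of_tendsto_of_tendsto_of_le_of_le (g := fun N => (t : ℝ) - h N)
      (h := fun _ => (t : ℝ)) ?_ tendsto_const_nhds (fun N => ?_) (fun N => ?_)
    · simpa using hh0.const_sub (t : ℝ)
    · have := hi2 N; simp only; linarith
    · have := hi1 N; simp only; linarith
  have htN : Tendsto (fun N => a + i N * h N) atTop (nhds t) := by
    rw [← NNReal.tendsto_coe]; push_cast; exact htR
  have hB := ((hcont ω).tendsto t).comp htN
  have hφt : Tendsto (fun N => φ (a + i N * h N)) atTop (nhds (φ t)) := by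
    refine (hφ t ht).tendsto.comp (tendsto_nhdsWithin_iff.2 ⟨htR, Eventually.of_forall fun N => ?_⟩)
    have h1 := hi1 N
    have h2 : (0 : ℝ) ≤ i N * h N := by positivity
    exact ⟨by linarith, by linarith [ht.2]⟩
  exact le_of_tendsto_of_tendsto' hφt hB fun N => (hω N (i N) (hi3 N)).le

theorem exists_le_barrier_measure (hB : IsPreBrownianReal B P)
    (hcont : ∀ ω, Continuous fun t => B t ω) (H : IsConcaveBarrier f g a b c C) :
    ∃ κ : ℝ, ∀ᶠ w : ℝ in atTop,
      ENNReal.ofReal (exp (-((w ^ 3) ^ 2 * barrierEnergy f g a b) / 2 - κ * w ^ 2)) ≤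
        P {ω | ∀ t : ℝ≥0, (t : ℝ) ∈ Icc (a : ℝ) b → w ^ 3 * f t < B t ω} := by
  have := hB.isGaussianProcess.isProbabilityMeasure
  have ha := H.pos
  have ha' : a ≠ 0 := by rintro rfl; simp at ha
  obtain ⟨c₁, hc₁, hbump⟩ := exists_le_lintegral_bump ha'
  obtain ⟨L, hL⟩ : ∃ L : ℝ, L = b - a := ⟨_, rfl⟩
  have hL0 : 0 < L := by linarith [H.lt]
  set K := barrierEnergy f g a b with hK
  have hK0 : 0 ≤ K := by
    rw [hK, barrierEnergy]
    have := intervalIntegral.integral_nonneg (μ := volume) (f := fun t => g t ^ 2) H.lt.le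
      fun t _ => sq_nonneg _
    positivity
  have hfa : 0 < f a := H.pos_of_mem ⟨le_rfl, H.lt.le⟩
  refine ⟨3 * K / 2 + 2 * (f a / a) + 24 * L + 1, ?_⟩
  filter_upwards [eventually_ge_atTop 1, eventually_ge_atTop (2 / c₁)] with w hw1 hw2
  have hw0 : 0 < w := by linarith
  set m := 1 / (2 * w) with hm
  have hm0 : 0 < m := by positivity
  have hm1 : m ≤ 1 / 2 := by
    rw [hm]; gcongr; linarith
  set v := w ^ 3 + 1 / w ^ 3 with hv
  have hw3 : 1 ≤ w ^ 3 := one_le_pow₀ hw1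
  have hwinv : 1 / w ^ 3 ≤ 1 := by rw [div_le_one (by positivity)]; exact hw3
  have hwinv0 : 0 < 1 / w ^ 3 := by positivity
  have hv0 : 0 < v := by positivity
  have hvw : w ^ 3 < v := by linarith
  obtain ⟨h, hh⟩ : ∃ h : ℕ → ℝ≥0, ∀ N, (h N : ℝ) = L * (1 / 2) ^ N :=
    ⟨fun N => ⟨L * (1 / 2) ^ N, by positivity⟩, fun _ => rfl⟩
  have hhL : ∀ N, (2 : ℝ) ^ N * h N = L := fun N => by
    rw [hh, one_div, inv_pow]; field_simp
  have hh0 : Tendsto (fun N => (h N : ℝ)) atTop (nhds 0) := by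
    simp_rw [hh]
    simpa using (tendsto_pow_atTop_nhds_zero_of_lt_one (by norm_num : (0 : ℝ) ≤ 1 / 2)
      (by norm_num)).const_mul L
  have hch : Tendsto (fun N => c * (h N : ℝ)) atTop (nhds 0) := by simpa using hh0.const_mul c
  obtain ⟨N₀, hN₀⟩ := eventually_atTop.1
    ((hh0.eventually_le_const (show 0 < m ^ 2 / 6 by positivity)).and
      (hch.eventually_le_const H.slope_pos))
  have hgrid : ∀ N ≥ N₀, ENNReal.ofReal
      (exp (-((w ^ 3) ^ 2 * K) / 2 - (3 * K / 2 + 2 * (f a / a) + 24 * L + 1) * w ^ 2)) ≤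
      P {ω | ∀ i : ℕ, i ≤ 2 ^ N → v * f (a + i * h N) < B (a + i * h N) ω} := by
    intro N hN
    obtain ⟨h1, h2⟩ := hN₀ N hN
    have hpos : (0 : ℝ) < h N := by rw [hh]; positivity
    have key := le_grid_measure hB H (n := 2 ^ N) (by exact_mod_cast hpos) Nat.one_le_two_pow
      (by push_cast; rw [hhL, hL]; ring) h2 hv0 hm0 (by linarith [sq_nonneg m])
    refine le_trans ?_ key
    refine le_trans ?_ (mul_le_mul_right (hbump m hm0 hm1) _)
    have hx : 3 * ((h N : ℝ) / m ^ 2) ≤ 1 / 2 := by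
      have := (div_le_iff₀ (show 0 < m ^ 2 by positivity)).2
        (show (h N : ℝ) ≤ 1 / 6 * m ^ 2 by linarith)
      linarith
    have hpow := exp_neg_le_one_sub_pow (by positivity) hx (2 ^ N)
    rw [← ENNReal.ofReal_mul (mul_nonneg (exp_nonneg _) ((exp_nonneg _).trans hpow))]
    refine ENNReal.ofReal_le_ofReal ?_
    have hc : exp (-w ^ 2) ≤ c₁ * m := by
      have e1 : w ^ 2 * exp (-w ^ 2) ≤ 1 := by
        rw [exp_neg, ← div_eq_mul_inv, div_le_one (exp_pos _)]
        linarith [add_one_le_exp (w ^ 2)]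
      have e2 : 2 ≤ c₁ * w := by rw [div_le_iff₀ hc₁] at hw2; linarith
      have e3 : c₁ * m * w ^ 2 = c₁ * w / 2 := by rw [hm]; field_simp
      have e4 : exp (-w ^ 2) * w ^ 2 ≤ c₁ * m * w ^ 2 := by rw [e3]; linarith
      exact le_of_mul_le_mul_right e4 (by positivity)
    refine le_trans ?_ (mul_le_mul (mul_le_mul_of_nonneg_left hpow (exp_nonneg _)) hc
      (exp_nonneg _) (mul_nonneg (exp_nonneg _) ((exp_nonneg _).trans hpow)))
    rw [← exp_add, ← exp_add]
    refine exp_le_exp.2 ?_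
    have e1 : ((2 ^ N : ℕ) : ℝ) * (3 * (h N / m ^ 2)) = 12 * L * w ^ 2 := by
      rw [← hhL N, hm]; push_cast; field_simp; ring
    have e2 : v ^ 2 ≤ (w ^ 3) ^ 2 + 3 := by
      have : v ^ 2 = (w ^ 3) ^ 2 + 2 + (1 / w ^ 3) ^ 2 := by rw [hv]; field_simp; ring
      rw [this]
      nlinarith
    have e3 : v * (2 * m) ≤ 2 * w ^ 2 := by
      have : v * (2 * m) * w = v := by rw [hm]; field_simp
      have h3 : v * (2 * m) * w ≤ 2 * w ^ 2 * w := by rw [this]; linarith [hv]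
      exact le_of_mul_le_mul_right h3 hw0
    have e4 : v * (f a / a) * (2 * m) ≤ 2 * (f a / a) * w ^ 2 := by
      have := mul_le_mul_of_nonneg_left e3 (show 0 ≤ f a / a by positivity)
      linarith
    have e5 : v ^ 2 * K ≤ ((w ^ 3) ^ 2 + 3) * K := mul_le_mul_of_nonneg_right e2 hK0
    have e6 : 3 * K / 2 ≤ 3 * K / 2 * w ^ 2 :=
      le_mul_of_one_le_right (by positivity) (one_le_pow₀ hw1)
    rw [e1, ← hK]
    linarith
  have hfc : ContinuousOn (fun t => v * f t) (Icc (a : ℝ) b) :=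
    continuousOn_const.mul fun t ht => (H.hasDerivAt t ht).continuousAt.continuousWithinAt
  refine (le_measure_of_forall_grid hB.aemeasurable hcont hfc H.lt (fun N => (hhL N).trans hL)
    hgrid).trans (measure_mono ?_)
  intro ω hω t ht
  exact lt_of_lt_of_le (mul_lt_mul_of_pos_right hvw (H.pos_of_mem ht)) (hω t ht)

end LowerBound

section Wiener

open scoped Topology

variable {Ω : Type*} {mΩ : MeasurableSpace Ω} {P : Measure Ω}

theorem variance_eq_of_map_eq_gaussianReal {Y : Ω → ℝ} {v : ℝ≥0}
    (h : P.map Y = gaussianReal 0 v) : variance Y P = v := by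
  rw [← variance_id_map (aemeasurable_of_map_eq_gaussianReal h), h, variance_id_gaussianReal]

theorem map_eq_gaussianReal_of_tendsto [IsProbabilityMeasure P] {Y : Ω → ℝ} {Z : ℕ → Ω → ℝ}
    {v : ℕ → ℝ≥0} {w : ℝ≥0} (hZ : ∀ n, P.map (Z n) = gaussianReal 0 (v n))
    (hlim : ∀ ω, Tendsto (fun n => Z n ω) atTop (𝓝 (Y ω)))
    (hv : Tendsto (fun n => (v n : ℝ)) atTop (𝓝 w)) : P.map Y = gaussianReal 0 w := by
  have hZm : ∀ n, AEMeasurable (Z n) P := fun n => aemeasurable_of_map_eq_gaussianReal (hZ n)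
  have hYm : AEMeasurable Y P :=
    aemeasurable_of_tendsto_metrizable_ae' hZm (Eventually.of_forall hlim)
  have := Measure.isProbabilityMeasure_map hYm
  refine Measure.ext_of_charFun (funext fun t => ?_)
  have hint : ∀ {W : Ω → ℝ}, AEMeasurable W P →
      charFun (P.map W) t = ∫ ω, Complex.exp (t * W ω * Complex.I) ∂P := fun hW => by
    rw [charFun_apply_real, integral_map hW (by fun_prop)]
  have h1 : Tendsto (fun n => charFun (P.map (Z n)) t) atTop (𝓝 (charFun (P.map Y) t)) := by
    simp_rw [hint hYm, hint (hZm _)]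
    refine tendsto_integral_of_dominated_convergence (fun _ => 1) (fun n => ?_)
      (integrable_const _) (fun n => Eventually.of_forall fun ω => ?_)
      (Eventually.of_forall fun ω => ?_)
    · have := hZm n
      fun_prop
    · rw [← Complex.ofReal_mul, Complex.norm_exp_ofReal_mul_I]
    · have hc : Continuous fun x : ℝ => Complex.exp (t * x * Complex.I) := by fun_prop
      exact (hc.tendsto _).comp (hlim ω)
  have h2 : Tendsto (fun n => charFun (P.map (Z n)) t) atTop
      (𝓝 (charFun (gaussianReal 0 w) t)) := by
    simp_rw [hZ, charFun_gaussianReal]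
    have hc : Continuous fun x : ℝ =>
        Complex.exp (t * ((0 : ℝ) : ℂ) * Complex.I - x * t ^ 2 / 2) := by fun_prop
    exact (hc.tendsto _).comp hv
  exact tendsto_nhds_unique h1 h2

theorem map_sum_increments_eq_gaussianReal {B : ℝ≥0 → Ω → ℝ} (hB : IsPreBrownianReal B P)
    {τ : ℕ → ℝ≥0} (hτ : Monotone τ) (c : ℕ → ℝ) (n : ℕ) :
    ∃ v : ℝ≥0, (v : ℝ) = ∑ k ∈ Finset.range n, c k ^ 2 * (τ (k + 1) - τ k) ∧
      P.map (fun ω => ∑ k ∈ Finset.range n, c k * (B (τ (k + 1)) ω - B (τ k) ω)) =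
        gaussianReal 0 v := by
  have := hB.isGaussianProcess.isProbabilityMeasure
  have hm : ∀ k, AEMeasurable (fun ω => c k * (B (τ (k + 1)) ω - B (τ k) ω)) P := fun k =>
    ((hB.aemeasurable _).sub (hB.aemeasurable _)).const_mul _
  have hind : iIndepFun (fun k ω => c k * (B (τ (k + 1)) ω - B (τ k) ω)) P :=
    (hB.hasIndepIncrements.nat hτ).comp (fun k x => c k * x) fun k => measurable_const_mul _
  induction n with
  | zero => exact ⟨0, by simp, by simp⟩
  | succ n ih =>
    obtain ⟨v, hv, hmap⟩ := ih
    have hlaw := gaussianReal_const_mul (hB.hasLaw_sub (τ (n + 1)) (τ n)) (c n)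
    refine ⟨v + NNReal.mk (c n ^ 2) (sq_nonneg _) * nndist (τ (n + 1) : ℝ) (τ n), ?_, ?_⟩
    · rw [Finset.sum_range_succ, ← hv]
      push_cast
      rw [Real.dist_eq, abs_of_nonneg (sub_nonneg.2 (by exact_mod_cast hτ n.le_succ))]
    · have hi : IndepFun (fun ω => ∑ k ∈ Finset.range n, c k * (B (τ (k + 1)) ω - B (τ k) ω))
          (fun ω => c n * (B (τ (n + 1)) ω - B (τ n) ω)) P := by
        have := hind.indepFun_finsetSum_of_notMem₀ hm (s := Finset.range n) (i := n) (by simp)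
        convert this using 1
        ext ω
        simp
      have := gaussianReal_add_gaussianReal_of_indepFun hi hmap hlaw.map_eq
      simp only [mul_zero, add_zero] at this
      refine Eq.trans (congrArg (fun f => P.map f) ?_) this
      ext ω
      simp [Finset.sum_range_succ]

end Wiener

section RiemannSum

open scoped Topology

theorem tendsto_sum_mul_integral {a b : ℝ} (hab : a < b) {φ ψ : ℝ → ℝ}
    (hφ : ContinuousOn φ (Icc a b)) (hψ : ContinuousOn ψ (Icc a b)) {ξ : ℕ → ℕ → ℝ}
    (hξ : ∀ n k : ℕ, ξ n k ∈ Icc (a + k * ((b - a) / (n + 1)))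
      (a + (k + 1 : ℕ) * ((b - a) / (n + 1)))) :
    Tendsto (fun n : ℕ => ∑ k ∈ Finset.range (n + 1), ψ (ξ n k) *
      ∫ t in (a + k * ((b - a) / (n + 1)))..(a + (k + 1 : ℕ) * ((b - a) / (n + 1))), φ t)
      atTop (𝓝 (∫ t in a..b, ψ t * φ t)) := by
  obtain ⟨M, hM⟩ := isCompact_Icc.exists_bound_of_continuousOn hφ
  have hM0 : 0 ≤ M := (norm_nonneg _).trans (hM a ⟨le_rfl, hab.le⟩)
  have hψφ : ContinuousOn (fun t => ψ t * φ t) (Icc a b) := hψ.mul hφ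
  rw [Metric.tendsto_atTop]
  intro ε hε
  set η := ε / (2 * (M + 1) * (b - a)) with hη
  have hba : 0 < b - a := sub_pos.2 hab
  have hη0 : 0 < η := by positivity
  obtain ⟨δ, hδ, hδψ⟩ := Metric.uniformContinuousOn_iff.1
    (isCompact_Icc.uniformContinuousOn_of_continuous hψ) η hη0
  obtain ⟨N, hN⟩ := exists_nat_gt ((b - a) / δ)
  refine ⟨N, fun n hn => ?_⟩
  have hn1 : (0 : ℝ) < n + 1 := by positivity
  set h := (b - a) / ((n : ℝ) + 1) with hh
  have hh0 : 0 < h := by positivity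
  have hhδ : h < δ := by
    rw [hh, div_lt_comm₀ hn1 hδ]
    refine hN.trans_le ?_
    have : (N : ℝ) ≤ n := by exact_mod_cast hn
    linarith
  have hend : a + ((n + 1 : ℕ) : ℝ) * h = b := by
    rw [hh]; push_cast; field_simp; ring
  have hmem : ∀ k : ℕ, k ≤ n + 1 → a + k * h ∈ Icc a b := fun k hk => by
    refine ⟨by have : 0 ≤ (k : ℝ) * h := by positivity
               linarith, ?_⟩
    rw [← hend]
    have : (k : ℝ) ≤ (n + 1 : ℕ) := by exact_mod_cast hk
    nlinarith
  have hlt : ∀ k : ℕ, a + k * h ≤ a + (k + 1 : ℕ) * h := fun k => by push_cast; linarith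
  have hsub : ∀ k < n + 1, uIcc (a + k * h) (a + (k + 1 : ℕ) * h) ⊆ Icc a b := fun k hk =>
    uIcc_subset_Icc (hmem k hk.le) (hmem (k + 1) hk)
  have hsum := intervalIntegral.sum_integral_adjacent_intervals (μ := volume)
    (f := fun t => ψ t * φ t) (a := fun k : ℕ => a + k * h) (n := n + 1)
    fun k hk => (hψφ.mono (hsub k hk)).intervalIntegrable
  simp only [Nat.cast_zero, zero_mul, add_zero, hend] at hsum
  rw [dist_eq_norm, ← hsum, ← Finset.sum_sub_distrib]
  have hterm : ∀ k ∈ Finset.range (n + 1), ‖ψ (ξ n k) *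
      (∫ t in (a + k * h)..(a + (k + 1 : ℕ) * h), φ t) -
      ∫ t in (a + k * h)..(a + (k + 1 : ℕ) * h), ψ t * φ t‖ ≤ η * M * h := by
    intro k hk
    have hk := Finset.mem_range.1 hk
    rw [← intervalIntegral.integral_const_mul, ← intervalIntegral.integral_sub
      ((hφ.mono (hsub k hk)).intervalIntegrable.const_mul _)
      (hψφ.mono (hsub k hk)).intervalIntegrable]
    have hw : |a + ((k + 1 : ℕ) : ℝ) * h - (a + k * h)| = h := by
      rw [show a + ((k + 1 : ℕ) : ℝ) * h - (a + k * h) = h by push_cast; ring, abs_of_pos hh0]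
    refine (intervalIntegral.norm_integral_le_of_norm_le_const (C := η * M)
      fun t ht => ?_).trans_eq (by rw [hw])
    have ht' := uIoc_subset_uIcc ht
    have htab := hsub k hk ht'
    rw [uIcc_of_le (hlt k)] at ht'
    have hξab : ξ n k ∈ Icc a b :=
      ⟨(hmem k hk.le).1.trans (hξ n k).1, (hξ n k).2.trans (hmem (k + 1) hk).2⟩
    rw [← sub_mul, norm_mul]
    refine mul_le_mul ?_ (hM t htab) (norm_nonneg _) hη0.le
    rw [← dist_eq_norm]
    refine (hδψ _ hξab _ htab ?_).le
    refine lt_of_le_of_lt ?_ hhδ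
    rw [Real.dist_eq, abs_le]
    have h1 := (hξ n k).1
    have h2 := (hξ n k).2
    rw [← hh] at h1 h2
    have h3 := ht'.1
    have h4 := ht'.2
    push_cast at h2 h4
    constructor <;> linarith
  refine (norm_sum_le_of_le _ hterm).trans_lt ?_
  rw [Finset.sum_const, Finset.card_range, nsmul_eq_mul]
  have : ((n + 1 : ℕ) : ℝ) * h = b - a := by linarith
  calc ((n + 1 : ℕ) : ℝ) * (η * M * h) = η * M * (((n + 1 : ℕ) : ℝ) * h) := by ring
    _ = ε / 2 * (M / (M + 1)) := by rw [this, hη]; field_simp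
    _ ≤ ε / 2 * 1 := by
        refine mul_le_mul_of_nonneg_left ?_ (by positivity)
        rw [div_le_one (by linarith)]; linarith
    _ < ε := by linarith

end RiemannSum

section WienerIntegral

open scoped Topology

theorem sum_mul_sub_eq_sub_add_sum (x y : ℕ → ℝ) (n : ℕ) :
    ∑ k ∈ Finset.range n, x k * (y (k + 1) - y k) =
      x n * y n - x 0 * y 0 + ∑ k ∈ Finset.range n, y (k + 1) * (x k - x (k + 1)) := by
  induction n with
  | zero => simp
  | succ n ih =>
    rw [Finset.sum_range_succ, Finset.sum_range_succ, ih]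
    ring

variable {Ω : Type*} {mΩ : MeasurableSpace Ω} {P : Measure Ω}

theorem map_wiener_integral_eq_gaussianReal {B : ℝ → Ω → ℝ}
    (hB : IsPreBrownianReal (fun t : ℝ≥0 => B t) P) {a b : ℝ} (ha : 0 < a) (hab : a < b)
    (hcont : ∀ ω, ContinuousOn (fun t => B t ω) (Icc a b)) {g φ : ℝ → ℝ}
    (hg : ∀ t ∈ Icc a b, HasDerivAt g (-φ t) t) (hφ : ContinuousOn φ (Icc a b)) (A : ℝ) :
    P.map (fun ω => (∫ t in a..b, B t ω * φ t) + (A - g a) * B a ω + g b * B b ω) =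
      gaussianReal 0 (A ^ 2 * a + ∫ t in a..b, g t ^ 2).toNNReal := by
  have := hB.isGaussianProcess.isProbabilityMeasure
  have hgc : ContinuousOn g (Icc a b) := fun t ht => (hg t ht).continuousAt.continuousWithinAt
  set t : ℕ → ℕ → ℝ := fun n k => a + k * ((b - a) / (n + 1)) with ht
  have hh : ∀ n : ℕ, 0 < (b - a) / ((n : ℝ) + 1) := fun n => by
    have := sub_pos.2 hab
    positivity
  have ht0 : ∀ n, t n 0 = a := fun n => by simp [ht]
  have htn : ∀ n, t n (n + 1) = b := fun n => by
    simp only [ht]; push_cast; field_simp; ring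
  have htm : ∀ n, Monotone (t n) := fun n => monotone_nat_of_le_succ fun k => by
    have := hh n
    simp only [ht]; push_cast; linarith
  have hat : ∀ n k, a ≤ t n k := fun n k => (ht0 n).symm.le.trans (htm n (Nat.zero_le k))
  have htb : ∀ n k, k ≤ n + 1 → t n k ≤ b := fun n k hk => (htm n hk).trans_eq (htn n)
  set τ : ℕ → ℕ → ℝ≥0 := fun n k => Nat.casesOn k 0 fun k => (t n k).toNNReal with hτ
  have hτm : ∀ n, Monotone (τ n) := fun n => monotone_nat_of_le_succ fun k => by
    cases k with
    | zero => simp [hτ]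
    | succ k => exact Real.toNNReal_le_toNNReal (htm n k.le_succ)
  have hτs : ∀ n k, (τ n (k + 1) : ℝ) = t n k := fun n k =>
    Real.coe_toNNReal _ (ha.le.trans (hat n k))
  have hτ0 : ∀ n, (τ n 0 : ℝ) = 0 := fun n => by simp [hτ]
  set c : ℕ → ℕ → ℝ := fun n k => Nat.casesOn k A fun k => g (t n k)
  have hc0 : ∀ n, c n 0 = A := fun _ => rfl
  have hcs : ∀ n k, c n (k + 1) = g (t n k) := fun _ _ => rfl
  have hsumZ : ∀ n ω, ∑ k ∈ Finset.range (n + 2),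
      c n k * (B (τ n (k + 1)) ω - B (τ n k) ω) =
      (∑ k ∈ Finset.range (n + 1), B (t n (k + 1)) ω * ∫ s in t n k..t n (k + 1), φ s) +
        ((A - g a) * B a ω + g b * B b ω - A * B 0 ω) := by
    intro n ω
    rw [Finset.sum_range_succ']
    simp only [hτs, hτ0, hc0, hcs]
    rw [sum_mul_sub_eq_sub_add_sum (fun k => g (t n k)) (fun k => B (t n k) ω), ht0, htn]
    have : ∀ k ∈ Finset.range (n + 1), B (t n (k + 1)) ω * (g (t n k) - g (t n (k + 1))) =
        B (t n (k + 1)) ω * ∫ s in t n k..t n (k + 1), φ s := by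
      intro k hk
      have hk := Finset.mem_range.1 hk
      have hsub : uIcc (t n k) (t n (k + 1)) ⊆ Icc a b :=
        uIcc_subset_Icc ⟨hat n k, htb n k hk.le⟩ ⟨hat n _, htb n _ hk⟩
      have := intervalIntegral.integral_eq_sub_of_hasDerivAt (fun s hs => hg s (hsub hs))
        (hφ.mono hsub).neg.intervalIntegrable
      rw [intervalIntegral.integral_neg] at this
      congr 1
      linarith
    rw [Finset.sum_congr rfl this]
    ring
  have hsumv : ∀ n, ∑ k ∈ Finset.range (n + 2), c n k ^ 2 * ((τ n (k + 1) : ℝ) - τ n k) =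
      (∑ k ∈ Finset.range (n + 1), g (t n k) ^ 2 * ∫ _ in t n k..t n (k + 1), (1 : ℝ)) +
        A ^ 2 * a := by
    intro n
    rw [Finset.sum_range_succ']
    simp only [hτs, hτ0, hc0, hcs, ht0, sub_zero, intervalIntegral.integral_const, smul_eq_mul, mul_one]
  choose v hv hmap using fun n => map_sum_increments_eq_gaussianReal hB (hτm n) (c n) (n + 2)
  have hK : 0 ≤ A ^ 2 * a + ∫ t in a..b, g t ^ 2 :=
    add_nonneg (by positivity) (intervalIntegral.integral_nonneg hab.le fun t _ => sq_nonneg _)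
  have key : P.map (fun ω => (∫ t in a..b, B t ω * φ t) +
      ((A - g a) * B a ω + g b * B b ω - A * B 0 ω)) =
      gaussianReal 0 (A ^ 2 * a + ∫ t in a..b, g t ^ 2).toNNReal := by
    refine map_eq_gaussianReal_of_tendsto hmap (fun ω => ?_) ?_
    · simp only [hsumZ]
      exact (tendsto_sum_mul_integral hab hφ (hcont ω)
        (ξ := fun n k => t n (k + 1)) fun n k => ⟨htm n k.le_succ, le_rfl⟩).add_const _
    · simp only [hv, hsumv, Real.coe_toNNReal _ hK]
      rw [add_comm (A ^ 2 * a)]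
      have := (tendsto_sum_mul_integral hab (φ := fun _ => 1) continuousOn_const (hgc.pow 2)
        (ξ := fun n k => t n k) fun n k => ⟨le_rfl, htm n k.le_succ⟩).add_const (A ^ 2 * a)
      simpa only [mul_one, Pi.pow_apply] using this
  rw [← key]
  refine Measure.map_congr ?_
  filter_upwards [hB.eval_zero_ae_eq_zero] with ω hω
  simp only [NNReal.coe_zero] at hω
  rw [hω]
  ring

end WienerIntegral

section PowerBarrier

variable {α a b : ℝ}

theorem continuousOn_rpow_const_Icc (ha : 0 < a) (p : ℝ) :
    ContinuousOn (fun t : ℝ => t ^ p) (Icc a b) := fun t ht =>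
  (continuousAt_rpow_const t p (Or.inl (ha.trans_le ht.1).ne')).continuousWithinAt

theorem hasDerivAt_mul_rpow_sub_one {t : ℝ} (ht : 0 < t) :
    HasDerivAt (fun t : ℝ => α * t ^ (α - 1)) (-(α * (1 - α) * t ^ (α - 2))) t := by
  have := (hasDerivAt_rpow_const (p := α - 1) (Or.inl ht.ne')).const_mul α
  refine this.congr_deriv ?_
  rw [show α - 1 - 1 = α - 2 by ring]
  ring

theorem isConcaveBarrier_rpow (hα : 0 < α ∧ α < 1) (hab : 0 < a ∧ a < b) :
    IsConcaveBarrier (fun t : ℝ => t ^ α) (fun t : ℝ => α * t ^ (α - 1)) a b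
      (α * (1 - α) * b ^ (α - 2)) (α * (1 - α) * a ^ (α - 2)) := by
  obtain ⟨hα0, hα1⟩ := hα
  obtain ⟨ha, hab⟩ := hab
  have hb := ha.trans hab
  have hk : 0 < α * (1 - α) := mul_pos hα0 (by linarith)
  have hφc : ContinuousOn (fun t : ℝ => α * (1 - α) * t ^ (α - 2)) (Icc a b) :=
    continuousOn_const.mul (continuousOn_rpow_const_Icc ha _)
  have hmem : ∀ t ∈ Icc a b, α * (1 - α) * t ^ (α - 2) ∈
      Icc (α * (1 - α) * b ^ (α - 2)) (α * (1 - α) * a ^ (α - 2)) := fun t ht =>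
    ⟨mul_le_mul_of_nonneg_left
      (rpow_le_rpow_of_nonpos (ha.trans_le ht.1) ht.2 (by linarith)) hk.le,
    mul_le_mul_of_nonneg_left (rpow_le_rpow_of_nonpos ha ht.1 (by linarith)) hk.le⟩
  have hsub : ∀ s t, a ≤ s → s ≤ t → t ≤ b →
      α * s ^ (α - 1) - α * t ^ (α - 1) = ∫ x in s..t, α * (1 - α) * x ^ (α - 2) ∧
      IntervalIntegrable (fun x : ℝ => α * (1 - α) * x ^ (α - 2)) volume s t := by
    intro s t hs hst ht
    have hI : uIcc s t ⊆ Icc a b := uIcc_subset_Icc ⟨hs, hst.trans ht⟩ ⟨hs.trans hst, ht⟩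
    have hint := (hφc.mono hI).intervalIntegrable (μ := volume)
    have := intervalIntegral.integral_eq_sub_of_hasDerivAt (fun x hx =>
      hasDerivAt_mul_rpow_sub_one (α := α) (ha.trans_le (hI hx).1)) hint.neg
    rw [intervalIntegral.integral_neg] at this
    exact ⟨by linarith, hint⟩
  refine ⟨ha, hab, by positivity, fun t ht => hasDerivAt_rpow_const
    (Or.inl (ha.trans_le ht.1).ne'), fun s t hs hst ht => ?_, fun s t hs hst ht => ?_, ?_, ?_⟩
  · obtain ⟨h1, h2⟩ := hsub s t hs hst ht
    rw [h1]
    have := intervalIntegral.integral_mono_on hst intervalIntegrable_const h2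
      fun x hx => (hmem x ⟨hs.trans hx.1, hx.2.trans ht⟩).1
    rw [intervalIntegral.integral_const, smul_eq_mul] at this
    linarith
  · obtain ⟨h1, h2⟩ := hsub s t hs hst ht
    rw [h1]
    have := intervalIntegral.integral_mono_on hst h2 intervalIntegrable_const
      fun x hx => (hmem x ⟨hs.trans hx.1, hx.2.trans ht⟩).2
    rw [intervalIntegral.integral_const, smul_eq_mul] at this
    linarith
  · rw [← rpow_sub_one ha.ne']
    have := rpow_pos_of_pos ha (α - 1)
    nlinarith
  · positivity

theorem barrierEnergy_rpow (ha : 0 < a) (hab : a < b) :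
    barrierEnergy (fun t : ℝ => t ^ α) (fun t : ℝ => α * t ^ (α - 1)) a b =
      (∫ x in a..b, α * (1 - α) * x ^ (2 * α - 2)) + (1 - α) * a ^ (2 * α - 1) +
        α * b ^ (2 * α - 1) := by
  have hI : uIcc a b = Icc a b := uIcc_of_le hab.le
  have hftc : ∫ x in a..b, (2 * α - 1) * x ^ (2 * α - 2) = b ^ (2 * α - 1) - a ^ (2 * α - 1) := by
    refine intervalIntegral.integral_eq_sub_of_hasDerivAt (f := fun x : ℝ => x ^ (2 * α - 1))
      (fun x hx => ?_) ?_
    · rw [hI] at hx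
      refine (hasDerivAt_rpow_const (Or.inl (ha.trans_le hx.1).ne')).congr_deriv ?_
      rw [show 2 * α - 1 - 1 = 2 * α - 2 by ring]
    · refine ContinuousOn.intervalIntegrable ?_
      rw [hI]
      exact continuousOn_const.mul (continuousOn_rpow_const_Icc ha _)
  have hsq : ∫ t in a..b, (α * t ^ (α - 1)) ^ 2 = ∫ t in a..b, α ^ 2 * t ^ (2 * α - 2) := by
    refine intervalIntegral.integral_congr fun t ht => ?_
    rw [hI] at ht
    have ht0 : 0 < t := ha.trans_le ht.1
    rw [mul_pow, ← rpow_natCast (t ^ (α - 1)), ← rpow_mul ht0.le]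
    congr 2
    push_cast
    ring
  have h0 : (a ^ α) ^ 2 / a = a ^ (2 * α - 1) := by
    rw [rpow_sub_one ha.ne', ← rpow_natCast (a ^ α), ← rpow_mul ha.le, mul_comm α]
    norm_num
  rw [intervalIntegral.integral_const_mul] at hftc
  rw [barrierEnergy, hsq, h0, intervalIntegral.integral_const_mul,
    intervalIntegral.integral_const_mul]
  linear_combination α * hftc

end PowerBarrier

section PowerMeasure

variable {α a b : ℝ}

/-- The measure `α (1 - α) x ^ (2 α - 2) dx` on `[a, b]`, with masses `(1 - α) a ^ (2 α - 1)` at `a`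
and `α b ^ (2 α - 1)` at `b`. -/
noncomputable def powerMeasure (α a b : ℝ) : Measure ℝ :=
  (volume.restrict (Icc a b)).withDensity
      (fun x => ENNReal.ofReal (α * (1 - α) * x ^ (2 * α - 2)))
    + ENNReal.ofReal ((1 - α) * a ^ (2 * α - 1)) • Measure.dirac a
    + ENNReal.ofReal (α * b ^ (2 * α - 1)) • Measure.dirac b

theorem integrableOn_density (ha : 0 < a) :
    IntegrableOn (fun x : ℝ => α * (1 - α) * x ^ (2 * α - 2)) (Icc a b) :=
  (continuousOn_const.mul (continuousOn_rpow_const_Icc ha _)).integrableOn_Icc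

theorem density_nonneg (hα : 0 < α ∧ α < 1) (ha : 0 < a) :
    ∀ᵐ x ∂volume.restrict (Icc a b), 0 ≤ α * (1 - α) * x ^ (2 * α - 2) := by
  filter_upwards [ae_restrict_mem measurableSet_Icc] with x hx
  have : 0 < x := ha.trans_le hx.1
  have : 0 ≤ 1 - α := by linarith [hα.2]
  have := hα.1.le
  positivity

theorem powerMeasure_Icc_toReal (hα : 0 < α ∧ α < 1) (hab : 0 < a ∧ a < b) :
    (powerMeasure α a b (Icc a b)).toReal =
      barrierEnergy (fun t : ℝ => t ^ α) (fun t : ℝ => α * t ^ (α - 1)) a b := by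
  obtain ⟨ha, hab⟩ := hab
  have hb := ha.trans hab
  have h1 : 0 ≤ 1 - α := by linarith [hα.2]
  have h2 := hα.1.le
  rw [barrierEnergy_rpow ha hab, powerMeasure, Measure.add_apply, Measure.add_apply,
    withDensity_apply _ measurableSet_Icc, Measure.restrict_restrict measurableSet_Icc, inter_self,
    ← ofReal_integral_eq_lintegral_ofReal (integrableOn_density ha) (density_nonneg hα ha),
    Measure.smul_apply, Measure.smul_apply, Measure.dirac_apply' _ measurableSet_Icc,
    Measure.dirac_apply' _ measurableSet_Icc, indicator_of_mem (left_mem_Icc.2 hab.le),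
    indicator_of_mem (right_mem_Icc.2 hab.le), intervalIntegral.integral_of_le hab.le,
    ← integral_Icc_eq_integral_Ioc]
  have h3 := integral_nonneg_of_ae (density_nonneg (a := a) (b := b) hα ha)
  simp only [Pi.one_apply, smul_eq_mul, mul_one]
  rw [← ENNReal.ofReal_add h3 (by positivity), ← ENNReal.ofReal_add (by positivity) (by positivity),
    ENNReal.toReal_ofReal (by positivity)]

theorem integral_powerMeasure (hα : 0 < α ∧ α < 1) (hab : 0 < a ∧ a < b) {x : ℝ → ℝ}
    (hx : ContinuousOn x (Icc a b)) :
    ∫ t, x t ∂powerMeasure α a b = (∫ t in a..b, α * (1 - α) * t ^ (2 * α - 2) * x t) +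
      (1 - α) * a ^ (2 * α - 1) * x a + α * b ^ (2 * α - 1) * x b := by
  obtain ⟨ha, hab⟩ := hab
  have hb := ha.trans hab
  have h1 : 0 ≤ 1 - α := by linarith [hα.2]
  have h2 := hα.1.le
  have hmeas : AEMeasurable (fun x : ℝ => (α * (1 - α) * x ^ (2 * α - 2)).toNNReal)
      (volume.restrict (Icc a b)) := by fun_prop
  have hprod : IntegrableOn (fun t => α * (1 - α) * t ^ (2 * α - 2) * x t) (Icc a b) :=
    ((continuousOn_const.mul (continuousOn_rpow_const_Icc ha _)).mul hx).integrableOn_Icc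
  have heq : (fun t : ℝ => (α * (1 - α) * t ^ (2 * α - 2)).toNNReal • x t)
      =ᵐ[volume.restrict (Icc a b)] fun t => α * (1 - α) * t ^ (2 * α - 2) * x t := by
    filter_upwards [density_nonneg hα ha] with t ht
    rw [NNReal.smul_def, Real.coe_toNNReal _ ht, smul_eq_mul]
  have hi1 : Integrable x ((volume.restrict (Icc a b)).withDensity
      fun x => ENNReal.ofReal (α * (1 - α) * x ^ (2 * α - 2))) :=
    (integrable_withDensity_iff_integrable_smul₀ hmeas).2 (hprod.congr heq.symm)
  have hdir : ∀ (c : ℝ) (p : ℝ), Integrable x (ENNReal.ofReal c • Measure.dirac p) := fun c p =>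
    (integrable_dirac (by simp)).smul_measure ENNReal.ofReal_ne_top
  rw [powerMeasure, integral_add_measure (hi1.add_measure (hdir _ _)) (hdir _ _),
    integral_add_measure hi1 (hdir _ _), integral_smul_measure, integral_smul_measure,
    integral_dirac, integral_dirac, ENNReal.toReal_ofReal (by positivity),
    ENNReal.toReal_ofReal (by positivity), intervalIntegral.integral_of_le hab.le,
    ← integral_Icc_eq_integral_Ioc, smul_eq_mul, smul_eq_mul]
  congr 2
  exact (integral_withDensity_eq_integral_smul₀ hmeas _).trans (integral_congr_ae heq)

end PowerMeasure

section Conclusion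

theorem liminf_limsup_log_of_exp_bounds {p : ℝ → ℝ≥0∞} {K κ₁ κ₂ : ℝ} (hp : ∀ u, p u ≠ ∞)
    (hκ : 0 < κ₁)
    (hle : ∀ᶠ w : ℝ in atTop,
      p (w ^ 3) ≤ ENNReal.ofReal (exp (-((w ^ 3) ^ 2 * K) / 2 - κ₁ * w ^ 2)))
    (hge : ∀ᶠ w : ℝ in atTop,
      ENNReal.ofReal (exp (-((w ^ 3) ^ 2 * K) / 2 - κ₂ * w ^ 2)) ≤ p (w ^ 3)) :
    (⊥ : EReal) < liminf (fun u : ℝ =>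
        ((u ^ (-(2 / 3) : ℝ) * (log (p u).toReal + K * u ^ 2 / 2) : ℝ) : EReal)) atTop ∧
      limsup (fun u : ℝ =>
        ((u ^ (-(2 / 3) : ℝ) * (log (p u).toReal + K * u ^ 2 / 2) : ℝ) : EReal)) atTop < 0 := by
  have hroot : Tendsto (fun u : ℝ => u ^ (1 / 3 : ℝ)) atTop atTop :=
    tendsto_rpow_atTop (by norm_num)
  have hbd : ∀ᶠ u : ℝ in atTop, u ^ (-(2 / 3) : ℝ) * (log (p u).toReal + K * u ^ 2 / 2) ∈
      Icc (-κ₂) (-κ₁) := by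
    filter_upwards [hroot.eventually hle, hroot.eventually hge, eventually_gt_atTop 0]
      with u h1 h2 hu
    have hcube : (u ^ (1 / 3 : ℝ)) ^ 3 = u := by
      rw [← rpow_natCast, ← rpow_mul hu.le]; norm_num
    have hsq : (u ^ (1 / 3 : ℝ)) ^ 2 = u ^ (2 / 3 : ℝ) := by
      rw [← rpow_natCast, ← rpow_mul hu.le]; norm_num
    rw [hcube, hsq] at h1 h2
    have h1 := ENNReal.toReal_le_of_le_ofReal (exp_pos _).le h1
    have h2 := (ENNReal.ofReal_le_iff_le_toReal (hp u)).1 h2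
    have hpos := (exp_pos _).trans_le h2
    have h1 := (log_le_iff_le_exp hpos).2 h1
    have h2 := (le_log_iff_exp_le hpos).2 h2
    have hinv : u ^ (-(2 / 3) : ℝ) * u ^ (2 / 3 : ℝ) = 1 := by
      rw [← rpow_add hu]; norm_num
    have hr : 0 ≤ u ^ (-(2 / 3) : ℝ) := by positivity
    constructor
    · calc -κ₂ = u ^ (-(2 / 3) : ℝ) * (-κ₂ * u ^ (2 / 3 : ℝ)) := by linear_combination κ₂ * hinv
        _ ≤ _ := mul_le_mul_of_nonneg_left (by linarith) hr
    · calc _ ≤ u ^ (-(2 / 3) : ℝ) * (-κ₁ * u ^ (2 / 3 : ℝ)) :=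
          mul_le_mul_of_nonneg_left (by linarith) hr
        _ = -κ₁ := by linear_combination -κ₁ * hinv
  constructor
  · refine (EReal.bot_lt_coe (-κ₂)).trans_le (le_liminf_of_le ?_ ?_)
    · isBoundedDefault
    · exact hbd.mono fun u hu => EReal.coe_le_coe_iff.2 hu.1
  · refine (limsup_le_of_le (a := ((-κ₁ : ℝ) : EReal)) ?_ ?_).trans_lt ?_
    · isBoundedDefault
    · exact hbd.mono fun u hu => EReal.coe_le_coe_iff.2 hu.2
    · exact_mod_cast neg_lt_zero.2 hκ

variable {Ω : Type*} {mΩ : MeasurableSpace Ω} {P : Measure Ω}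

theorem variance_integral_powerMeasure {α a b : ℝ} (hα : 0 < α ∧ α < 1) (hab : 0 < a ∧ a < b)
    {B : ℝ → Ω → ℝ} (hB : IsPreBrownianReal (fun t : ℝ≥0 => B t) P)
    (hcont : ∀ ω, ContinuousOn (fun t => B t ω) (Icc a b)) :
    variance (fun ω => ∫ t, t ^ (-α) * B t ω ∂powerMeasure α a b) P =
      barrierEnergy (fun t : ℝ => t ^ α) (fun t : ℝ => α * t ^ (α - 1)) a b := by
  have ha := hab.1
  have hb := ha.trans hab.2
  have hlaw := map_wiener_integral_eq_gaussianReal hB ha hab.2 hcont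
    (fun t ht => hasDerivAt_mul_rpow_sub_one (α := α) (ha.trans_le ht.1))
    (continuousOn_const.mul (continuousOn_rpow_const_Icc ha _)) (a ^ α / a)
  have hA : (a ^ α / a) ^ 2 * a = (a ^ α) ^ 2 / a := by field_simp
  have hK : 0 ≤ (a ^ α) ^ 2 / a + ∫ t in a..b, (α * t ^ (α - 1)) ^ 2 :=
    add_nonneg (by positivity)
      (intervalIntegral.integral_nonneg hab.2.le fun t _ => sq_nonneg _)
  have hY : (fun ω => ∫ t, t ^ (-α) * B t ω ∂powerMeasure α a b) = fun ω =>
      (∫ t in a..b, B t ω * (α * (1 - α) * t ^ (α - 2))) +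
        (a ^ α / a - α * a ^ (α - 1)) * B a ω + α * b ^ (α - 1) * B b ω := by
    ext ω
    have hpow : ∀ {t : ℝ}, 0 < t → ∀ p : ℝ, t ^ p * t ^ (-α) = t ^ (p - α) := fun ht p => by
      rw [← rpow_add ht, sub_eq_add_neg]
    rw [integral_powerMeasure (x := fun t => t ^ (-α) * B t ω) hα hab ((continuousOn_rpow_const_Icc ha _).mul (hcont ω)),
      ← rpow_sub_one ha.ne']
    have e1 := hpow ha (2 * α - 1)
    have e2 := hpow hb (2 * α - 1)
    rw [show 2 * α - 1 - α = α - 1 by ring] at e1 e2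
    have e3 : ∫ t in a..b, α * (1 - α) * t ^ (2 * α - 2) * (t ^ (-α) * B t ω) =
        ∫ t in a..b, B t ω * (α * (1 - α) * t ^ (α - 2)) := by
      refine intervalIntegral.integral_congr fun t ht => ?_
      rw [uIcc_of_le hab.2.le] at ht
      have e := hpow (ha.trans_le ht.1) (2 * α - 2)
      rw [show 2 * α - 2 - α = α - 2 by ring] at e
      linear_combination α * (1 - α) * B t ω * e
    linear_combination e3 + (1 - α) * B a ω * e1 + α * B b ω * e2
  rw [hY, variance_eq_of_map_eq_gaussianReal hlaw, hA, Real.coe_toNNReal _ hK, barrierEnergy]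

end Conclusion

end HighMinima

/-- Let `B` be standard Brownian motion, `0 < α < 1`, `0 < a < b`,
`X(t) = t^{-α} B(t)` and `X_* = min_{[a,b]} X`. With
`μ_α(dx) = α(1-α)x^{2α-2} dx + (1-α)a^{2α-1} δ_a(dx) + α b^{2α-1} δ_b(dx)` and
`σ*²(a,b;α) = μ_α([a,b])^{-2} Var(∫_a^b X dμ_α)`, one has
`liminf_{u→∞} u^{-2/3}(log P(X_* > u) + u²/(2σ*²)) > -∞` and
`limsup_{u→∞} u^{-2/3}(log P(X_* > u) + u²/(2σ*²)) < 0`. -/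
theorem power_normalized_BM_high_minima_two_thirds_correction
    {Ω : Type*} [MeasurableSpace Ω] (P : Measure Ω) [IsProbabilityMeasure P]
    (α a b : ℝ) (hα : 0 < α ∧ α < 1) (hab : 0 < a ∧ a < b)
    (B : ℝ → Ω → ℝ)
    -- B is a standard Brownian motion: a centered Gaussian process on [0,∞)
    (hGauss : ∀ (n : ℕ) (t : Fin n → ℝ), (∀ i, 0 ≤ t i) → ∀ c : Fin n → ℝ,
      ∃ v : NNReal,
        Measure.map (fun ω => ∑ i, c i * B (t i) ω) P = gaussianReal 0 v)
    -- with continuous sample paths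
    (hpath : ∀ ω, ContinuousOn (fun t => B t ω) (Ici 0))
    -- and covariance min(s,t)
    (hcovB : ∀ s t : ℝ, 0 ≤ s → 0 ≤ t → (∫ ω, B s ω * B t ω ∂P) = min s t)
    -- the process X(t) = t^{-α} B(t)
    (X : ℝ → Ω → ℝ) (hX : ∀ t ω, X t ω = t ^ (-α) * B t ω)
    -- the measure μ_α
    (μ : Measure ℝ)
    (hμ : μ = (volume.restrict (Icc a b)).withDensity
          (fun x => ENNReal.ofReal (α * (1 - α) * x ^ (2 * α - 2)))
        + ENNReal.ofReal ((1 - α) * a ^ (2 * α - 1)) • Measure.dirac a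
        + ENNReal.ofReal (α * b ^ (2 * α - 1)) • Measure.dirac b)
    -- the pathwise integral of X against μ_α
    (Y : Ω → ℝ) (hY : ∀ ω, Y ω = ∫ t, X t ω ∂μ)
    -- σ*²(a,b;α)
    (σsq : ℝ) (hσsq : σsq = variance Y P / ((μ (Icc a b)).toReal) ^ 2) :
    (⊥ : EReal) <
      Filter.liminf (fun u : ℝ =>
        ((u ^ (-(2/3) : ℝ) *
          (Real.log (P {ω | ∀ t ∈ Icc a b, u < X t ω}).toReal
            + u ^ 2 / (2 * σsq)) : ℝ) : EReal)) Filter.atTop ∧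
    Filter.limsup (fun u : ℝ =>
        ((u ^ (-(2/3) : ℝ) *
          (Real.log (P {ω | ∀ t ∈ Icc a b, u < X t ω}).toReal
            + u ^ 2 / (2 * σsq)) : ℝ) : EReal)) Filter.atTop < 0 := by
  have hB := isPreBrownianReal_of_gaussian hGauss hcovB
  have H := isConcaveBarrier_rpow hα hab
  set K := barrierEnergy (fun t : ℝ => t ^ α) (fun t : ℝ => α * t ^ (α - 1)) a b with hK
  have ha := hab.1
  have hK0 : 0 < K := by
    have : 0 < (a ^ α) ^ 2 / a := by positivity
    exact add_pos_of_pos_of_nonneg this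
      (intervalIntegral.integral_nonneg hab.2.le fun t _ => sq_nonneg _)
  have hσ : ∀ u : ℝ, u ^ 2 / (2 * σsq) = K * u ^ 2 / 2 := fun u => by
    have hμ' : μ = powerMeasure α a b := hμ
    have hY' : Y = fun ω => ∫ t, t ^ (-α) * B t ω ∂powerMeasure α a b := by
      ext ω
      rw [hY, hμ']
      simp_rw [hX]
    rw [hσsq, hY', variance_integral_powerMeasure hα hab hB fun ω =>
      (hpath ω).mono fun t ht => ha.le.trans ht.1, hμ', powerMeasure_Icc_toReal hα hab, ← hK]
    field_simp
  have hev : ∀ u : ℝ, {ω | ∀ t ∈ Icc a b, u < X t ω} =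
      {ω | ∀ t : NNReal, (t : ℝ) ∈ Icc a b → u * (t : ℝ) ^ α < B t ω} := fun u => by
    have hiff : ∀ t ∈ Icc a b, ∀ ω, u < X t ω ↔ u * t ^ α < B t ω := fun t ht ω => by
      have ht0 := ha.trans_le ht.1
      rw [hX, rpow_neg ht0.le, ← div_eq_inv_mul, lt_div_iff₀ (rpow_pos_of_pos ht0 α)]
    ext ω
    exact ⟨fun h t ht => (hiff t ht ω).1 (h t ht), fun h t ht =>
      (hiff t ht ω).2 (h ⟨t, ha.le.trans ht.1⟩ ht)⟩
  lift a to NNReal using ha.le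
  obtain ⟨κ₁, hκ₁, hle⟩ := exists_barrier_measure_le hB H
  obtain ⟨κ₂, hge⟩ := exists_le_barrier_measure hB
    (fun ω => (hpath ω).comp_continuous NNReal.continuous_coe fun t => t.2) H
  simp_rw [hσ, hev]
  exact liminf_limsup_log_of_exp_bounds (fun _ => measure_ne_top _ _) hκ₁ hle hge
end
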